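/- arXiv:2202.07243 — 5 statements merged into one kernel-verified Lean document; each statement's English description precedes it below -/
import Mathlib

section
/- Let p be a prime and let R be a (not necessarily commutative) ring with identity with exactly p² elements. Then R is commutative, and R is isomorphic as a ring to one of the following four rings: ℤ/p²ℤ, (ℤ/pℤ) × (ℤ/pℤ), 𝔽_p[t]/(t²), or the field 𝔽_{p²} with p² elements. -/
open Polynomial

section ZModAlgebra

variable {p : ℕ} [Fact p.Prime] {R : Type*} [Ring R] [Algebra (ZMod p) R] [Fintype R]

/-- In a `ZMod p`-algebra of order `p²`, any non-scalar `x` yields a basis `1, x`. -/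
theorem bijective_algebraMap_add_smul (hcard : Fintype.card R = p ^ 2) {x : R}
    (hx : x ∉ Set.range (algebraMap (ZMod p) R)) :
    Function.Bijective
      fun q : ZMod p × ZMod p => algebraMap (ZMod p) R q.1 + q.2 • x := by
  have : Nontrivial R := Fintype.one_lt_card_iff_nontrivial.mp <| by
    rw [hcard]; exact Nat.one_lt_pow two_ne_zero (Fact.out : p.Prime).one_lt
  rw [Fintype.bijective_iff_injective_and_card]
  refine ⟨?_, by simp [hcard, ZMod.card, sq]⟩
  rintro ⟨a, b⟩ ⟨c, d⟩ h
  dsimp only at h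
  have hsub : (b - d) • x = algebraMap (ZMod p) R (c - a) := by
    rw [sub_smul, map_sub, sub_eq_sub_iff_add_eq_add, add_comm, h, add_comm]
  obtain hbd | hbd := eq_or_ne (b - d) 0
  · rw [hbd, zero_smul, eq_comm, map_eq_zero_iff _ (algebraMap (ZMod p) R).injective] at hsub
    rw [sub_eq_zero.mp hbd, sub_eq_zero.mp hsub]
  · refine absurd ⟨(b - d)⁻¹ * (c - a), ?_⟩ hx
    rw [map_mul, ← hsub, ← Algebra.smul_def, inv_smul_smul₀ hbd]

theorem mul_comm_of_card_eq_prime_sq (hcard : Fintype.card R = p ^ 2) (a b : R) :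
    a * b = b * a := by
  by_cases ha : a ∈ Set.range (algebraMap (ZMod p) R)
  · obtain ⟨r, rfl⟩ := ha
    exact Algebra.commutes r b
  · obtain ⟨⟨r, s⟩, rfl⟩ := (bijective_algebraMap_add_smul hcard ha).2 b
    simp only [mul_add, add_mul, mul_smul_comm, smul_mul_assoc, Algebra.commutes r a]

/-- If such an algebra has zero divisors, some non-scalar element is idempotent or squares
to zero. -/
theorem exists_mul_self_eq_zero_or_self (hcard : Fintype.card R = p ^ 2) {x y : R}
    (hx : x ≠ 0) (hy : y ≠ 0) (hxy : x * y = 0) :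
    ∃ e : R, e ∉ Set.range (algebraMap (ZMod p) R) ∧ (e * e = 0 ∨ e * e = e) := by
  have hxr : x ∉ Set.range (algebraMap (ZMod p) R) := by
    rintro ⟨r, rfl⟩
    have hr : r ≠ 0 := by rintro rfl; exact hx (map_zero _)
    rw [← Algebra.smul_def, smul_eq_zero_iff_right hr] at hxy
    exact hy hxy
  obtain ⟨⟨r, s⟩, rfl⟩ := (bijective_algebraMap_add_smul hcard hxr).2 y
  dsimp only at hxy hy
  rw [mul_add, mul_smul_comm, ← Algebra.commutes, ← Algebra.smul_def] at hxy
  have hs : s ≠ 0 := by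
    rintro rfl
    rw [zero_smul, add_zero] at hxy hy
    have hr : r ≠ 0 := by rintro rfl; exact hy (map_zero _)
    exact hx ((smul_eq_zero_iff_right hr).mp hxy)
  have hxx : x * x = (-(s⁻¹ * r)) • x := by
    rw [neg_smul, mul_smul, eq_neg_of_add_eq_zero_left hxy, smul_neg, inv_smul_smul₀ hs, neg_neg]
  obtain hc | hc := eq_or_ne (-(s⁻¹ * r)) 0
  · exact ⟨x, hxr, .inl (by rw [hxx, hc, zero_smul])⟩
  · generalize -(s⁻¹ * r) = c at hxx hc
    refine ⟨c⁻¹ • x, ?_, .inr ?_⟩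
    · rintro ⟨t, ht⟩
      refine hxr ⟨c * t, ?_⟩
      rw [map_mul, ht, ← Algebra.smul_def, smul_inv_smul₀ hc]
    · rw [smul_mul_smul_comm, hxx, smul_smul, mul_assoc, inv_mul_cancel₀ hc, mul_one]

theorem nonempty_ringEquiv_prod_of_mul_self (hcard : Fintype.card R = p ^ 2) {e : R}
    (he : e ∉ Set.range (algebraMap (ZMod p) R)) (hee : e * e = e) :
    Nonempty (R ≃+* (ZMod p × ZMod p)) := by
  have hb := bijective_algebraMap_add_smul hcard he
  let f : ZMod p × ZMod p →+* R :=
    { toFun := fun q => algebraMap (ZMod p) R q.1 + (q.2 - q.1) • e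
      map_one' := by simp
      map_zero' := by simp
      map_add' := fun a b => by
        simp only [Prod.fst_add, Prod.snd_add, map_add]
        module
      map_mul' := fun a b => by
        simp only [Prod.fst_mul, Prod.snd_mul, Algebra.algebraMap_eq_smul_one, mul_add, add_mul,
          smul_mul_assoc, mul_smul_comm, one_mul, mul_one, hee]
        module }
  refine ⟨(RingEquiv.ofBijective f ?_).symm⟩
  rw [Fintype.bijective_iff_injective_and_card]
  refine ⟨fun a b h => ?_, by simp [hcard, ZMod.card, sq]⟩
  obtain ⟨h₁, h₂⟩ := Prod.ext_iff.mp (@hb.1 (a.1, a.2 - a.1) (b.1, b.2 - b.1) h)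
  dsimp only at h₁ h₂
  exact Prod.ext h₁ (by rwa [h₁, sub_left_inj] at h₂)

theorem nonempty_ringEquiv_quotient_X_sq (hcard : Fintype.card R = p ^ 2) {x : R}
    (hx : x ∉ Set.range (algebraMap (ZMod p) R)) (hxx : x * x = 0) :
    Nonempty (R ≃+* ((ZMod p)[X] ⧸ Ideal.span {(X : (ZMod p)[X]) ^ 2})) := by
  have hmem : ∀ a ∈ Ideal.span {(X : (ZMod p)[X]) ^ 2},
      (aeval x : (ZMod p)[X] →ₐ[ZMod p] R).toRingHom a = 0 := by
    intro a ha
    obtain ⟨b, rfl⟩ := Ideal.mem_span_singleton.mp ha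
    simp [sq, hxx]
  have hX : Nat.card ((ZMod p)[X] ⧸ Ideal.span {(X : (ZMod p)[X]) ^ 2}) = p ^ 2 := by
    have : Module.Finite (ZMod p) ((ZMod p)[X] ⧸ Ideal.span {(X : (ZMod p)[X]) ^ 2}) :=
      (monic_X_pow 2).finite_quotient
    rw [Module.natCard_eq_pow_finrank (K := ZMod p), finrank_quotient_span_eq_natDegree]
    simp
  have : Finite ((ZMod p)[X] ⧸ Ideal.span {(X : (ZMod p)[X]) ^ 2}) :=
    Nat.finite_of_card_ne_zero (by rw [hX]; exact pow_ne_zero _ (Fact.out : p.Prime).ne_zero)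
  refine ⟨(RingEquiv.ofBijective (Ideal.Quotient.lift _ _ hmem) ?_).symm⟩
  refine Function.Surjective.bijective_of_nat_card_le (fun z => ?_)
    (by rw [hX, Nat.card_eq_fintype_card, hcard])
  obtain ⟨⟨r, s⟩, rfl⟩ := (bijective_algebraMap_add_smul hcard hx).2 z
  exact ⟨Ideal.Quotient.mk _ (C r + s • X), by simp⟩

end ZModAlgebra

theorem nonempty_ringEquiv_galoisField_of_isDomain {p n : ℕ} [Fact p.Prime] {R : Type*}
    [CommRing R] [Algebra (ZMod p) R] [Fintype R] [IsDomain R] (hcard : Fintype.card R = p ^ n) :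
    Nonempty (R ≃+* GaloisField p n) := by
  let : Field R := (Finite.isField_of_domain R).toField
  exact ⟨(GaloisField.algEquivGaloisFieldOfFintype p n hcard).toRingEquiv⟩

/-- Classification of unital rings of order `p²`: any (not necessarily commutative) ring
with identity having exactly `p²` elements is commutative, and is isomorphic as a ring to
`ℤ/p²ℤ`, `(ℤ/pℤ) × (ℤ/pℤ)`, `𝔽_p[t]/(t²)` or the field `𝔽_{p²}` with `p²` elements. -/
theorem ring_of_card_p_sq_classification (p : ℕ) [Fact p.Prime]
    (R : Type) [Ring R] [Fintype R] (hcard : Fintype.card R = p ^ 2) :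
    (∀ a b : R, a * b = b * a) ∧
    (Nonempty (R ≃+* ZMod (p ^ 2)) ∨
      Nonempty (R ≃+* (ZMod p × ZMod p)) ∨
      Nonempty (R ≃+* ((ZMod p)[X] ⧸ Ideal.span {(X : (ZMod p)[X]) ^ 2})) ∨
      Nonempty (R ≃+* GaloisField p 2)) := by
  have hp : p.Prime := Fact.out
  have : Nontrivial R := Fintype.one_lt_card_iff_nontrivial.mp <| by
    rw [hcard]; exact Nat.one_lt_pow two_ne_zero hp.one_lt
  have hdvd : ringChar R ∣ p ^ 2 := ringChar.dvd (hcard ▸ Nat.cast_card_eq_zero R)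
  obtain ⟨k, hk, hchar⟩ := (Nat.dvd_prime_pow hp).mp hdvd
  have : CharP R (p ^ k) := ringChar.of_eq hchar
  interval_cases k
  · rw [pow_zero] at hchar
    exact absurd (ringChar.ringChar_eq_one.mp hchar) (not_subsingleton R)
  · rw [pow_one] at this
    let _ : Algebra (ZMod p) R := ZMod.algebra R p
    have hcomm := mul_comm_of_card_eq_prime_sq (p := p) hcard
    refine ⟨hcomm, ?_⟩
    by_cases hdom : NoZeroDivisors R
    · let _ : CommRing R := { ‹Ring R› with mul_comm := hcomm }
      have : IsDomain R := NoZeroDivisors.to_isDomain R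
      exact .inr (.inr (.inr (nonempty_ringEquiv_galoisField_of_isDomain hcard)))
    · obtain ⟨x, y, hxy, hx, hy⟩ : ∃ x y : R, x * y = 0 ∧ x ≠ 0 ∧ y ≠ 0 := by
        by_contra! h
        exact hdom ⟨fun {a b} hab => or_iff_not_imp_left.mpr (h a b hab)⟩
      obtain ⟨e, he, hee | hee⟩ := exists_mul_self_eq_zero_or_self hcard hx hy hxy
      · exact .inr (.inr (.inl (nonempty_ringEquiv_quotient_X_sq hcard he hee)))
      · exact .inr (.inl (nonempty_ringEquiv_prod_of_mul_self hcard he hee))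
  · let e := ZMod.ringEquiv R hcard
    exact ⟨fun a b => e.symm.injective (by rw [map_mul, map_mul, mul_comm]), .inl ⟨e.symm⟩⟩
end

section
/- Let p be an odd prime. Then the Schur multiplier H²(H₃(𝔽_p[t]/(t²)), ℂˣ) of the Heisenberg group H₃(𝔽_p[t]/(t²)) is isomorphic as an abelian group to (ℤ/pℤ)⁸. -/
open Polynomial

/-- The Heisenberg group `H₃(R)` of 3×3 upper unitriangular matrices over a commutative
ring `R`.  An element is determined by its entries: `b` is the (1,2)-entry, `a` is the
(2,3)-entry and `c` is the (1,3)-entry; multiplication is matrix multiplication. -/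
@[ext]
structure Heisenberg (R : Type*) [CommRing R] where
  a : R
  b : R
  c : R

namespace Heisenberg

variable {R : Type*} [CommRing R]

instance : Mul (Heisenberg R) :=
  ⟨fun x y => ⟨x.a + y.a, x.b + y.b, x.c + y.c + x.b * y.a⟩⟩

instance : One (Heisenberg R) := ⟨⟨0, 0, 0⟩⟩

instance : Inv (Heisenberg R) := ⟨fun x => ⟨-x.a, -x.b, -x.c + x.b * x.a⟩⟩

@[simp] lemma mul_a (x y : Heisenberg R) : (x * y).a = x.a + y.a := rfl
@[simp] lemma mul_b (x y : Heisenberg R) : (x * y).b = x.b + y.b := rfl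
@[simp] lemma mul_c (x y : Heisenberg R) : (x * y).c = x.c + y.c + x.b * y.a := rfl
@[simp] lemma one_a : (1 : Heisenberg R).a = 0 := rfl
@[simp] lemma one_b : (1 : Heisenberg R).b = 0 := rfl
@[simp] lemma one_c : (1 : Heisenberg R).c = 0 := rfl
@[simp] lemma inv_a (x : Heisenberg R) : x⁻¹.a = -x.a := rfl
@[simp] lemma inv_b (x : Heisenberg R) : x⁻¹.b = -x.b := rfl
@[simp] lemma inv_c (x : Heisenberg R) : x⁻¹.c = -x.c + x.b * x.a := rfl

/-- Matrix multiplication of unitriangular matrices makes `H₃(R)` a group. -/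
instance : Group (Heisenberg R) where
  mul := (· * ·)
  one := 1
  inv := (·⁻¹)
  mul_assoc x y z := by ext <;> simp only [mul_a, mul_b, mul_c] <;> ring
  one_mul x := by ext <;> simp only [mul_a, mul_b, mul_c, one_a, one_b, one_c] <;> ring
  mul_one x := by ext <;> simp only [mul_a, mul_b, mul_c, one_a, one_b, one_c] <;> ring
  inv_mul_cancel x := by
    ext <;> simp only [mul_a, mul_b, mul_c, inv_a, inv_b, inv_c, one_a, one_b, one_c] <;> ring

end Heisenberg

section Cocycles

variable {G : Type*} [Group G]

/-- A (normalized) `2`-cocycle of `G` with values in `ℂˣ` (trivial action):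
`α(1,1) = 1` and `α(x,y)α(xy,z) = α(x,yz)α(y,z)`. -/
def IsMul2Cocycle (α : G × G → ℂˣ) : Prop :=
  α (1, 1) = 1 ∧ ∀ x y z : G, α (x, y) * α (x * y, z) = α (x, y * z) * α (y, z)

/-- A (normalized) `2`-coboundary of `G` with values in `ℂˣ`. -/
def IsMul2Coboundary (β : G × G → ℂˣ) : Prop :=
  ∃ f : G → ℂˣ, f 1 = 1 ∧ ∀ x y : G, β (x, y) = f x * f y * (f (x * y))⁻¹

/-- Two `2`-cocycles `α, α'` are cohomologous if they differ by a `2`-coboundary: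
`α'(x,y) = f(x)f(y)f(xy)⁻¹α(x,y)` for some `f : G → ℂˣ` with `f 1 = 1`. -/
def IsCohomologous (α α' : G × G → ℂˣ) : Prop :=
  ∃ f : G → ℂˣ, f 1 = 1 ∧ ∀ x y : G, α' (x, y) = f x * f y * (f (x * y))⁻¹ * α (x, y)

/-- The group of normalized `2`-cocycles of `G` with values in `ℂˣ`. -/
def mul2Cocycles (G : Type*) [Group G] : Subgroup ((G × G) → ℂˣ) where
  carrier := {α | IsMul2Cocycle α}
  one_mem' := ⟨rfl, fun _ _ _ => rfl⟩
  mul_mem' {a b} ha hb := by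
    refine ⟨by simp only [Pi.mul_apply, ha.1, hb.1, one_mul], fun x y z => ?_⟩
    simp only [Pi.mul_apply]
    rw [mul_mul_mul_comm, ha.2 x y z, hb.2 x y z, mul_mul_mul_comm]
  inv_mem' {a} ha := by
    refine ⟨by simp only [Pi.inv_apply, ha.1, inv_one], fun x y z => ?_⟩
    simp only [Pi.inv_apply]
    rw [← mul_inv, ← mul_inv, ha.2 x y z]

/-- The group of `2`-coboundaries of `G` with values in `ℂˣ`. -/
def mul2Coboundaries (G : Type*) [Group G] : Subgroup ((G × G) → ℂˣ) where
  carrier := {β | IsMul2Coboundary β}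
  one_mem' := ⟨1, rfl, fun x y => by simp⟩
  mul_mem' {a b} ha hb := by
    obtain ⟨f, hf1, hf⟩ := ha
    obtain ⟨g, hg1, hg⟩ := hb
    refine ⟨f * g, by simp [hf1, hg1], fun x y => ?_⟩
    simp only [Pi.mul_apply, hf x y, hg x y, mul_inv]
    rw [mul_mul_mul_comm (f x) (g x) (f y) (g y),
      mul_mul_mul_comm (f x * f y) (g x * g y) (f (x * y))⁻¹ (g (x * y))⁻¹]
  inv_mem' {a} ha := by
    obtain ⟨f, hf1, hf⟩ := ha
    refine ⟨f⁻¹, by simp [hf1], fun x y => ?_⟩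
    simp only [Pi.inv_apply, hf x y, mul_inv, inv_inv]

/-- The Schur multiplier `H²(G, ℂˣ)`: the second group cohomology of `G` with
coefficients in `ℂˣ` (trivial action), realized as normalized `2`-cocycles modulo
`2`-coboundaries. -/
abbrev SchurMultiplier (G : Type*) [Group G] :=
  mul2Cocycles G ⧸ (mul2Coboundaries G).subgroupOf (mul2Cocycles G)

end Cocycles

section Transport

variable {G H : Type*} [Group G] [Group H]

/-- Pulling back `2`-cocycles along an isomorphism of groups. -/
def mul2CocyclesCongr (e : G ≃* H) : mul2Cocycles G ≃* mul2Cocycles H where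
  toFun α := ⟨fun q => α.1 (e.symm q.1, e.symm q.2), by
    refine ⟨by simpa using α.2.1, fun x y z => ?_⟩
    simpa using α.2.2 (e.symm x) (e.symm y) (e.symm z)⟩
  invFun α := ⟨fun q => α.1 (e q.1, e q.2), by
    refine ⟨by simpa using α.2.1, fun x y z => ?_⟩
    simpa using α.2.2 (e x) (e y) (e z)⟩
  left_inv α := by ext; simp
  right_inv α := by ext; simp
  map_mul' α β := rfl

/-- Isomorphic groups have isomorphic Schur multipliers. -/
def schurMultiplierCongr (e : G ≃* H) : SchurMultiplier G ≃* SchurMultiplier H :=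
  QuotientGroup.congr _ _ (mul2CocyclesCongr e) (by
    ext α
    simp only [Subgroup.mem_map, Subgroup.mem_subgroupOf]
    constructor
    · rintro ⟨β, ⟨f, hf1, hf⟩, rfl⟩
      refine ⟨fun x => f (e.symm x), by simpa using hf1, fun x y => ?_⟩
      beta_reduce
      rw [map_mul]
      exact hf (e.symm x) (e.symm y)
    · rintro ⟨f, hf1, hf⟩
      refine ⟨(mul2CocyclesCongr e).symm α, ⟨fun x => f (e x), by simpa using hf1,
        fun x y => ?_⟩, by simp⟩
      beta_reduce
      rw [map_mul]
      exact hf (e x) (e y))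

end Transport

/-- An isomorphism of rings induces an isomorphism of Heisenberg groups. -/
def Heisenberg.congr {R S : Type*} [CommRing R] [CommRing S] (e : R ≃+* S) :
    Heisenberg R ≃* Heisenberg S where
  toFun x := ⟨e x.a, e x.b, e x.c⟩
  invFun x := ⟨e.symm x.a, e.symm x.b, e.symm x.c⟩
  left_inv x := by simp
  right_inv x := by simp
  map_mul' x y := by ext <;> simp

/-- The map from the dual numbers over `K` to `K[X] / (X²)` sending `ε` to the class of `X`. -/
noncomputable def dualNumberToQuotientXSq (K : Type*) [CommRing K] :
    DualNumber K →ₐ[K] (K[X] ⧸ Ideal.span {(X : K[X]) ^ 2}) :=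
  DualNumber.lift ⟨(Algebra.ofId K _, Ideal.Quotient.mk _ X), by
    rw [← map_mul, ← pow_two]
    exact Ideal.Quotient.eq_zero_iff_mem.2 (Ideal.subset_span rfl), fun a => mul_comm _ _⟩

theorem dualNumberToQuotientXSq_eps (K : Type*) [CommRing K] :
    dualNumberToQuotientXSq K DualNumber.eps = Ideal.Quotient.mk _ X :=
  DualNumber.lift_apply_eps _

/-- `K[X] / (X²)` is the ring of dual numbers over `K`. -/
noncomputable def quotientXSqEquivDualNumber (K : Type*) [CommRing K] :
    (K[X] ⧸ Ideal.span {(X : K[X]) ^ 2}) ≃ₐ[K] DualNumber K :=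
  AlgEquiv.ofAlgHom
    (Ideal.Quotient.liftₐ _ (aeval (DualNumber.eps : DualNumber K)) fun f hf => by
      obtain ⟨g, rfl⟩ := Ideal.mem_span_singleton'.1 hf
      simp)
    (dualNumberToQuotientXSq K)
    (by
      apply DualNumber.algHom_ext
      rw [AlgHom.comp_apply, dualNumberToQuotientXSq_eps]
      exact aeval_X _)
    (by
      apply Ideal.Quotient.algHom_ext
      apply Polynomial.algHom_ext
      change dualNumberToQuotientXSq K (aeval (DualNumber.eps : DualNumber K) X) = _
      rw [aeval_X, dualNumberToQuotientXSq_eps]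
      rfl)

section GroupLemmas

variable {E : Type*} [Group E]

/-- An element which commutes with `x` and `y` up to sufficiently central factors commutes with
their commutator. -/
theorem commute_of_mul_eq_mul_mul {g x y c u v : E} (hc : x * y = y * x * c)
    (hx : g * x = x * g * u) (hy : g * y = y * g * v)
    (hug : Commute u g) (hux : Commute u x) (huy : Commute u y)
    (hvg : Commute v g) (hvx : Commute v x) (hvy : Commute v y) (huv : Commute u v) :
    Commute g c := by
  have hcx : c = (y * x)⁻¹ * (x * y) := by rw [hc]; group
  have hx' : g * x * g⁻¹ = x * u := by
    rw [hx, mul_assoc x, hug.symm.eq]; group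
  have hy' : g * y * g⁻¹ = y * v := by
    rw [hy, mul_assoc y, hvg.symm.eq]; group
  have huvc : Commute (u * v) ((y * x)⁻¹ * (x * y)) :=
    ((huy.mul_right hux).inv_right.mul_right (hux.mul_right huy)).mul_left
      ((hvy.mul_right hvx).inv_right.mul_right (hvx.mul_right hvy))
  have key : g * c * g⁻¹ = c := by
    calc g * c * g⁻¹
        = ((g * y * g⁻¹) * (g * x * g⁻¹))⁻¹ * ((g * x * g⁻¹) * (g * y * g⁻¹)) := by
          rw [hcx]; group
      _ = (y * x * (v * u))⁻¹ * (x * y * (u * v)) := by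
          rw [hx', hy']
          congr 1
          · rw [show y * v * (x * u) = y * (v * x) * u by group, hvx.eq]; group
          · rw [show x * u * (y * v) = x * (u * y) * v by group, huy.eq]; group
      _ = (v * u)⁻¹ * ((y * x)⁻¹ * (x * y) * (u * v)) := by group
      _ = (v * u)⁻¹ * ((u * v) * ((y * x)⁻¹ * (x * y))) := by rw [huvc.eq]
      _ = c := by rw [huv.eq, hcx]; group
  exact mul_inv_eq_iff_eq_mul.1 key

theorem mul_pow_eq_of_commute {x y z : E} (h : y * x = x * y * z) (hx : Commute z x)
    (j : ℕ) : y * x ^ j = x ^ j * y * z ^ j := by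
  induction j with
  | zero => simp
  | succ j ih =>
    calc y * x ^ (j + 1) = (y * x ^ j) * x := by rw [pow_succ]; group
      _ = x ^ j * y * (z ^ j * x) := by rw [ih]; group
      _ = x ^ j * (y * x) * z ^ j := by rw [(hx.pow_left j).eq]; group
      _ = x ^ (j + 1) * y * z ^ (j + 1) := by rw [h, pow_succ, pow_succ']; group

theorem pow_mul_pow_eq_of_commute {x y z : E} (h : y * x = x * y * z) (hx : Commute z x)
    (hy : Commute z y) (i j : ℕ) : y ^ i * x ^ j = x ^ j * y ^ i * z ^ (i * j) := by
  induction i with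
  | zero => simp
  | succ i ih =>
    calc y ^ (i + 1) * x ^ j = y * (y ^ i * x ^ j) := by rw [pow_succ']; group
      _ = (y * x ^ j) * y ^ i * z ^ (i * j) := by rw [ih]; group
      _ = x ^ j * y * (z ^ j * y ^ i) * z ^ (i * j) := by
          rw [mul_pow_eq_of_commute h hx j]; group
      _ = x ^ j * (y * y ^ i) * (z ^ j * z ^ (i * j)) := by
          rw [((hy.pow_left j).pow_right i).eq]; group
      _ = _ := by rw [← pow_succ', ← pow_add, add_mul, one_mul, add_comm (i * j)]

theorem pow_eq_one_of_mul_eq {x y z : E} (h : y * x = x * y * z) (hx : Commute z x) {n : ℕ}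
    (hn : Commute (x ^ n) y) : z ^ n = 1 := by
  have h1 := mul_pow_eq_of_commute h hx n
  rw [← hn.eq] at h1
  exact (mul_eq_left.1 h1.symm)

theorem pow_eq_one_of_mul_eq_of_central {x y c z : E} (h : y * x = x * y * c)
    (hx : Commute c x) (hc : y * c = c * y * z) (hz : ∀ e, Commute z e) {n : ℕ}
    (hzn : z ^ n = 1) (hn : Commute (x ^ n) y) : c ^ n = 1 := by
  have h1 : y * x = x * (c * z) * y := by
    rw [h, mul_assoc x y c, hc, mul_assoc c y z, ← (hz y).eq]; group
  have h2 : y * x ^ n * y⁻¹ = x ^ n * c ^ n := by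
    calc y * x ^ n * y⁻¹ = (y * x * y⁻¹) ^ n := by rw [conj_pow]
      _ = (x * (c * z)) ^ n := by rw [h1, mul_inv_cancel_right]
      _ = x ^ n * c ^ n := by
          rw [((hx.mul_left (hz x)).symm : Commute x (c * z)).mul_pow,
            ((hz c).symm : Commute c z).mul_pow, hzn, mul_one]
  rw [← hn.eq, mul_inv_cancel_right] at h2
  exact mul_eq_left.1 h2.symm

theorem pow_val_mul {p : ℕ} {g : E} (hg : g ^ p = 1) (i j : ZMod p) :
    g ^ (i * j).val = g ^ (i.val * j.val) := by
  rw [ZMod.val_mul, ← pow_eq_pow_mod _ hg]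

variable {p : ℕ} [NeZero p]

theorem pow_val_add {g : E} (hg : g ^ p = 1) (i j : ZMod p) :
    g ^ (i + j).val = g ^ i.val * g ^ j.val := by
  rw [← pow_add, ZMod.val_add, ← pow_eq_pow_mod _ hg]

open TrivSqZeroExt in
/-- Elements `A₀, A₁, B₀, B₁` of a group which satisfy the defining relations of the Heisenberg
group over the dual numbers define a homomorphism. -/
theorem exists_heisenberg_dualNumber_hom {A₀ A₁ B₀ B₁ C₀ C₁ : E}
    (hA₀ : A₀ ^ p = 1) (hA₁ : A₁ ^ p = 1) (hB₀ : B₀ ^ p = 1) (hB₁ : B₁ ^ p = 1)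
    (hAA : Commute A₁ A₀) (hBB : Commute B₁ B₀) (h11 : Commute B₁ A₁)
    (h00 : B₀ * A₀ = A₀ * B₀ * C₀) (h01 : B₀ * A₁ = A₁ * B₀ * C₁)
    (h10 : B₁ * A₀ = A₀ * B₁ * C₁)
    (hC₀A₀ : Commute C₀ A₀) (hC₀A₁ : Commute C₀ A₁) (hC₀B₀ : Commute C₀ B₀)
    (hC₀B₁ : Commute C₀ B₁) (hC₁A₀ : Commute C₁ A₀) (hC₁A₁ : Commute C₁ A₁)
    (hC₁B₀ : Commute C₁ B₀) (hC₁B₁ : Commute C₁ B₁) :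
    ∃ σ : Heisenberg (DualNumber (ZMod p)) →* E, ∀ x, σ x =
      A₀ ^ (fst x.a).val * A₁ ^ (snd x.a).val * (B₀ ^ (fst x.b).val * B₁ ^ (snd x.b).val) *
        (C₀ ^ (fst x.c).val * C₁ ^ (snd x.c).val) := by
  have hC₀ : C₀ ^ p = 1 :=
    pow_eq_one_of_mul_eq h00 hC₀A₀ (by rw [hA₀]; exact Commute.one_left _)
  have hC₁ : C₁ ^ p = 1 :=
    pow_eq_one_of_mul_eq h01 hC₁A₁ (by rw [hA₁]; exact Commute.one_left _)
  have hCC : Commute C₁ C₀ := by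
    have : C₀ = (A₀ * B₀)⁻¹ * (B₀ * A₀) := by rw [h00]; group
    rw [this]
    exact (hC₁A₀.mul_right hC₁B₀).inv_right.mul_right (hC₁B₀.mul_right hC₁A₀)
  let φA : DualNumber (ZMod p) → E := fun r => A₀ ^ (fst r).val * A₁ ^ (snd r).val
  let φB : DualNumber (ZMod p) → E := fun r => B₀ ^ (fst r).val * B₁ ^ (snd r).val
  let φC : DualNumber (ZMod p) → E := fun r => C₀ ^ (fst r).val * C₁ ^ (snd r).val
  have add {g h : E} (hg : g ^ p = 1) (hh : h ^ p = 1) (hc : Commute h g)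
      (r s : DualNumber (ZMod p)) : g ^ (fst (r + s)).val * h ^ (snd (r + s)).val =
        g ^ (fst r).val * h ^ (snd r).val * (g ^ (fst s).val * h ^ (snd s).val) := by
    rw [fst_add, snd_add, pow_val_add hg, pow_val_add hh, (hc.pow_pow _ _).mul_mul_mul_comm]
  have hφA (r s) : φA (r + s) = φA r * φA s := add hA₀ hA₁ hAA r s
  have hφB (r s) : φB (r + s) = φB r * φB s := add hB₀ hB₁ hBB r s
  have hφC (r s) : φC (r + s) = φC r * φC s := add hC₀ hC₁ hCC r s
  have hCA (r s) : Commute (φC r) (φA s) :=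
    (((hC₀A₀.pow_pow _ _).mul_right (hC₀A₁.pow_pow _ _)).mul_left
      ((hC₁A₀.pow_pow _ _).mul_right (hC₁A₁.pow_pow _ _)))
  have hCB (r s) : Commute (φC r) (φB s) :=
    (((hC₀B₀.pow_pow _ _).mul_right (hC₀B₁.pow_pow _ _)).mul_left
      ((hC₁B₀.pow_pow _ _).mul_right (hC₁B₁.pow_pow _ _)))
  have hBA (r s) : φB r * φA s = φA s * φB r * φC (r * s) := by
    have e00 (i j : ZMod p) := pow_mul_pow_eq_of_commute h00 hC₀A₀ hC₀B₀ i.val j.val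
    have e01 (i j : ZMod p) := pow_mul_pow_eq_of_commute h01 hC₁A₁ hC₁B₀ i.val j.val
    have e10 (i j : ZMod p) := pow_mul_pow_eq_of_commute h10 hC₁A₀ hC₁B₁ i.val j.val
    have e11 (i j : ZMod p) := (h11.pow_pow i.val j.val).eq
    simp only [← pow_val_mul hC₀, ← pow_val_mul hC₁] at e00 e01 e10
    simp only [φA, φB, φC, DualNumber.snd_mul, fst_mul, pow_val_add hC₁]
    generalize fst r = r₀
    generalize snd r = r₁
    generalize fst s = s₀
    generalize snd s = s₁
    calc B₀ ^ r₀.val * B₁ ^ r₁.val * (A₀ ^ s₀.val * A₁ ^ s₁.val)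
        = B₀ ^ r₀.val * (B₁ ^ r₁.val * A₀ ^ s₀.val) * A₁ ^ s₁.val := by group
      _ = B₀ ^ r₀.val * A₀ ^ s₀.val * B₁ ^ r₁.val * (C₁ ^ (r₁ * s₀).val * A₁ ^ s₁.val) := by
          rw [e10]; group
      _ = (B₀ ^ r₀.val * A₀ ^ s₀.val) * (B₁ ^ r₁.val * A₁ ^ s₁.val) * C₁ ^ (r₁ * s₀).val := by
          rw [(hC₁A₁.pow_pow _ _).eq]; group
      _ = A₀ ^ s₀.val * B₀ ^ r₀.val * (C₀ ^ (r₀ * s₀).val * A₁ ^ s₁.val) * B₁ ^ r₁.val *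
            C₁ ^ (r₁ * s₀).val := by
          rw [e00, e11]; group
      _ = A₀ ^ s₀.val * (B₀ ^ r₀.val * A₁ ^ s₁.val) * (C₀ ^ (r₀ * s₀).val * B₁ ^ r₁.val) *
            C₁ ^ (r₁ * s₀).val := by
          rw [(hC₀A₁.pow_pow _ _).eq]; group
      _ = A₀ ^ s₀.val * A₁ ^ s₁.val * B₀ ^ r₀.val * (C₁ ^ (r₀ * s₁).val * B₁ ^ r₁.val) *
            (C₀ ^ (r₀ * s₀).val * C₁ ^ (r₁ * s₀).val) := by
          rw [e01, (hC₀B₁.pow_pow _ _).eq]; group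
      _ = A₀ ^ s₀.val * A₁ ^ s₁.val * (B₀ ^ r₀.val * B₁ ^ r₁.val) *
            (C₁ ^ (r₀ * s₁).val * C₀ ^ (r₀ * s₀).val * C₁ ^ (r₁ * s₀).val) := by
          rw [(hC₁B₁.pow_pow _ _).eq]; group
      _ = _ := by rw [(hCC.pow_pow _ _).eq]; group
  refine ⟨MonoidHom.mk' (fun x => φA x.a * φB x.b * φC x.c) fun x y => ?_, fun x => rfl⟩
  simp only [Heisenberg.mul_a, Heisenberg.mul_b, Heisenberg.mul_c, hφA, hφB, hφC]
  calc φA x.a * φA y.a * (φB x.b * φB y.b) * (φC x.c * φC y.c * φC (x.b * y.a))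
      = φA x.a * φA y.a * φB x.b * φB y.b * (φC (x.c + y.c + x.b * y.a)) := by
        rw [hφC, hφC]; group
    _ = φA x.a * φA y.a * φB x.b * φB y.b * (φC (x.b * y.a + (x.c + y.c))) := by
        rw [add_comm (x.c + y.c)]
    _ = φA x.a * φA y.a * φB x.b * (φB y.b * φC (x.b * y.a)) * (φC x.c * φC y.c) := by
        rw [hφC, hφC]; group
    _ = φA x.a * (φA y.a * φB x.b * φC (x.b * y.a)) * (φB y.b * φC x.c) * φC y.c := by
        rw [← (hCB (x.b * y.a) y.b).eq]; group
    _ = φA x.a * φB x.b * (φA y.a * φC x.c) * φB y.b * φC y.c := by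
        rw [← hBA, ← (hCB x.c y.b).eq]; group
    _ = φA x.a * φB x.b * φC x.c * (φA y.a * φB y.b * φC y.c) := by
        rw [← (hCA x.c y.a).eq]; group

end GroupLemmas

section CentralExtension

variable {G : Type*} [Group G]

/-- The central extension of `G` by `ℂˣ` defined by a `2`-cocycle. -/
@[ext]
structure CocycleExtension (α : mul2Cocycles G) where
  base : G
  scalar : ℂˣ

namespace CocycleExtension

variable {α : mul2Cocycles G}

theorem cocycle_one_left (α : mul2Cocycles G) (x : G) : α.1 (1, x) = 1 := by
  have h := α.2.2 1 1 x
  simpa [α.2.1] using h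

theorem cocycle_one_right (α : mul2Cocycles G) (x : G) : α.1 (x, 1) = 1 := by
  have h := α.2.2 x 1 1
  simpa [α.2.1] using h

instance : Mul (CocycleExtension α) :=
  ⟨fun x y => ⟨x.base * y.base, x.scalar * y.scalar * α.1 (x.base, y.base)⟩⟩

instance : One (CocycleExtension α) := ⟨⟨1, 1⟩⟩

instance : Inv (CocycleExtension α) :=
  ⟨fun x => ⟨x.base⁻¹, x.scalar⁻¹ * (α.1 (x.base⁻¹, x.base))⁻¹⟩⟩

@[simp] theorem mul_base (x y : CocycleExtension α) : (x * y).base = x.base * y.base := rfl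
@[simp] theorem mul_scalar (x y : CocycleExtension α) :
    (x * y).scalar = x.scalar * y.scalar * α.1 (x.base, y.base) := rfl
@[simp] theorem one_base : (1 : CocycleExtension α).base = 1 := rfl
@[simp] theorem one_scalar : (1 : CocycleExtension α).scalar = 1 := rfl
@[simp] theorem inv_base (x : CocycleExtension α) : x⁻¹.base = x.base⁻¹ := rfl
@[simp] theorem inv_scalar (x : CocycleExtension α) :
    x⁻¹.scalar = x.scalar⁻¹ * (α.1 (x.base⁻¹, x.base))⁻¹ := rfl

instance : Group (CocycleExtension α) where
  mul_assoc x y z := by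
    ext1
    · simp only [mul_base, mul_assoc]
    · have h := α.2.2 x.base y.base z.base
      simp only [mul_base, mul_scalar]
      calc x.scalar * y.scalar * α.1 (x.base, y.base) * z.scalar * α.1 (x.base * y.base, z.base)
          = x.scalar * y.scalar * z.scalar *
            (α.1 (x.base, y.base) * α.1 (x.base * y.base, z.base)) := by
              simp only [mul_comm, mul_assoc, mul_left_comm]
        _ = _ := by
              rw [h]
              simp only [mul_comm, mul_assoc, mul_left_comm]
  one_mul x := by ext1 <;> simp [cocycle_one_left]
  mul_one x := by ext1 <;> simp [cocycle_one_right]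
  inv_mul_cancel x := by
    ext1
    · simp
    · simp [mul_comm]

/-- The projection onto the base. -/
def proj (α : mul2Cocycles G) : CocycleExtension α →* G := MonoidHom.mk' base mul_base

/-- The central subgroup `ℂˣ`. -/
def incl (α : mul2Cocycles G) : ℂˣ →* CocycleExtension α :=
  MonoidHom.mk' (fun u => ⟨1, u⟩) fun u v => by ext1 <;> simp [α.2.1]

@[simp] theorem proj_apply (x : CocycleExtension α) : proj α x = x.base := rfl
@[simp] theorem incl_base (u : ℂˣ) : (incl α u).base = 1 := rfl
@[simp] theorem incl_scalar (u : ℂˣ) : (incl α u).scalar = u := rfl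

theorem incl_injective : Function.Injective (incl α) := fun u v h => by
  simpa using congrArg scalar h

@[simp] theorem pow_base (x : CocycleExtension α) (n : ℕ) : (x ^ n).base = x.base ^ n :=
  map_pow (proj α) x n

theorem incl_commute (u : ℂˣ) (x : CocycleExtension α) : Commute (incl α u) x := by
  ext1 <;> simp [cocycle_one_left, cocycle_one_right, mul_comm]

theorem exists_eq_incl {x : CocycleExtension α} (hx : x.base = 1) : ∃ u, x = incl α u :=
  ⟨x.scalar, by ext1 <;> simp [hx]⟩

theorem commute_of_base_eq_one {x : CocycleExtension α} (hx : x.base = 1)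
    (y : CocycleExtension α) : Commute x y := by
  obtain ⟨u, rfl⟩ := exists_eq_incl hx
  exact incl_commute u y

/-- An element of order dividing `n` lifts to an element of order dividing `n`. -/
theorem exists_lift (α : mul2Cocycles G) {x : G} {n : ℕ} (hn : 0 < n) (hx : x ^ n = 1) :
    ∃ e : CocycleExtension α, e.base = x ∧ e ^ n = 1 := by
  obtain ⟨w, hw⟩ := exists_eq_incl (x := (⟨x, 1⟩ : CocycleExtension α) ^ n) (by simpa using hx)
  obtain ⟨z, hz⟩ := IsAlgClosed.exists_pow_nat_eq (w⁻¹ : ℂˣ).val hn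
  have hz0 : z ≠ 0 := by
    rintro rfl
    rw [zero_pow hn.ne'] at hz
    exact (w⁻¹).ne_zero hz.symm
  have hu : (Units.mk0 z hz0) ^ n = w⁻¹ := by ext; simpa using hz
  refine ⟨incl α (Units.mk0 z hz0) * ⟨x, 1⟩, by simp, ?_⟩
  rw [(incl_commute _ _).mul_pow, hw, ← map_pow, hu, ← map_mul]
  simp

theorem isMul2Coboundary_of_section (σ : G →* CocycleExtension α)
    (hσ : ∀ x, (σ x).base = x) : IsMul2Coboundary α.1 := by
  refine ⟨fun x => (σ x).scalar⁻¹, by simp, fun x y => ?_⟩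
  simp only [map_mul, mul_scalar, hσ]
  rw [inv_inv, ← mul_inv, inv_mul_cancel_left]

end CocycleExtension

/-- The factor by which lifts of `x` and `y` to the extension defined by `α` fail to commute,
for commuting `x` and `y`. -/
def commutatorPairing (x y : G) : (G × G → ℂˣ) →* ℂˣ where
  toFun α := α (x, y) * (α (y, x))⁻¹
  map_one' := by simp
  map_mul' α β := by simp only [Pi.mul_apply, mul_inv]; rw [mul_mul_mul_comm]

/-- The factor by which the commutator of lifts of `y` and `x` to the extension defined by `α`
differs from the standard lift of `c`, if `y * x = x * y * c`. -/
def commutatorFactor (x y c : G) : (G × G → ℂˣ) →* ℂˣ where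
  toFun α := α (y, x) * (α (x, y) * α (x * y, c))⁻¹
  map_one' := by simp
  map_mul' α β := by
    simp only [Pi.mul_apply, mul_inv]
    simp only [mul_assoc, mul_left_comm]

namespace CocycleExtension

variable {α : mul2Cocycles G}

theorem mul_eq_mul_mul_incl {x y : CocycleExtension α} (h : Commute x.base y.base) :
    x * y = y * x * incl α (commutatorPairing x.base y.base α.1) := by
  ext1
  · simpa using h.eq
  · simp [commutatorPairing, cocycle_one_right, mul_comm, mul_left_comm]

theorem commute_of_commutatorPairing_eq_one {x y : CocycleExtension α}
    (h : Commute x.base y.base) (h1 : commutatorPairing x.base y.base α.1 = 1) :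
    Commute x y := by
  have := mul_eq_mul_mul_incl h
  rwa [h1, map_one, mul_one] at this

theorem commute_commutator {g x y c : CocycleExtension α} (hc : x * y = y * x * c)
    (hx : Commute g.base x.base) (hy : Commute g.base y.base) : Commute g c :=
  commute_of_mul_eq_mul_mul hc (mul_eq_mul_mul_incl hx) (mul_eq_mul_mul_incl hy)
    (incl_commute _ _) (incl_commute _ _) (incl_commute _ _) (incl_commute _ _)
    (incl_commute _ _) (incl_commute _ _) (incl_commute _ _)

theorem mul_eq_mul_mul_incl_mul {x y : CocycleExtension α} {c : G}
    (h : y.base * x.base = x.base * y.base * c) :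
    y * x = x * y * (incl α (commutatorFactor x.base y.base c α.1) * ⟨c, 1⟩) := by
  ext1
  · simpa using h
  · simp [commutatorFactor, cocycle_one_left, mul_comm, mul_left_comm]

theorem commutatorPairing_pow_eq_one (α : mul2Cocycles G) {x y : G} (h : Commute x y) {n : ℕ}
    (hy : y ^ n = 1) : commutatorPairing x y α.1 ^ n = 1 := by
  apply incl_injective (α := α)
  rw [map_pow, map_one]
  exact pow_eq_one_of_mul_eq (mul_eq_mul_mul_incl (α := α) (x := ⟨x, 1⟩) (y := ⟨y, 1⟩) h)
    (incl_commute _ _) (commute_of_base_eq_one (by simpa using hy) _)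

end CocycleExtension

theorem commutatorPairing_coboundary {β : G × G → ℂˣ} (hβ : IsMul2Coboundary β) {x y : G}
    (h : Commute x y) : commutatorPairing x y β = 1 := by
  obtain ⟨f, -, hf⟩ := hβ
  simp only [commutatorPairing, MonoidHom.coe_mk, OneHom.coe_mk, hf, h.eq]
  rw [mul_comm (f y) (f x), mul_inv_cancel]

theorem commutatorFactor_coboundary {f : G → ℂˣ} {β : G × G → ℂˣ}
    (hβ : ∀ x y, β (x, y) = f x * f y * (f (x * y))⁻¹) {x y c : G}
    (h : y * x = x * y * c) : commutatorFactor x y c β = (f c)⁻¹ := by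
  simp only [commutatorFactor, MonoidHom.coe_mk, OneHom.coe_mk, hβ, h]
  ext
  push_cast
  field_simp

/-- Additive `2`-cocycles give multiplicative ones by composing with a character. -/
theorem isMul2Cocycle_comp {A : Type*} [AddCommGroup A] (χ : Multiplicative A →* ℂˣ)
    {P : G → G → A} (h1 : P 1 1 = 0)
    (h : ∀ x y z, P x y + P (x * y) z = P x (y * z) + P y z) :
    IsMul2Cocycle fun q : G × G => χ (.ofAdd (P q.1 q.2)) :=
  ⟨by simp [h1], fun x y z => by simp only [← map_mul, ← ofAdd_add, h]⟩

end CentralExtension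

namespace Heisenberg

section Generators

variable {R : Type*} [CommRing R]

/-- The unitriangular matrix with `(2,3)`-entry `r`. -/
def ofA (r : R) : Heisenberg R := ⟨r, 0, 0⟩

/-- The unitriangular matrix with `(1,2)`-entry `r`. -/
def ofB (r : R) : Heisenberg R := ⟨0, r, 0⟩

/-- The unitriangular matrix with `(1,3)`-entry `r`. -/
def ofC (r : R) : Heisenberg R := ⟨0, 0, r⟩

theorem ofA_mul_ofA (r s : R) : ofA r * ofA s = ofA (r + s) := by ext <;> simp [ofA]

theorem ofB_mul_ofB (r s : R) : ofB r * ofB s = ofB (r + s) := by ext <;> simp [ofB]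

theorem ofC_mul_ofC (r s : R) : ofC r * ofC s = ofC (r + s) := by ext <;> simp [ofC]

theorem ofA_pow (r : R) (n : ℕ) : ofA r ^ n = ofA (n * r) := by
  induction n with
  | zero => ext <;> simp [ofA]
  | succ n ih => rw [pow_succ, ih, ofA_mul_ofA]; push_cast; ring_nf

theorem ofB_pow (r : R) (n : ℕ) : ofB r ^ n = ofB (n * r) := by
  induction n with
  | zero => ext <;> simp [ofB]
  | succ n ih => rw [pow_succ, ih, ofB_mul_ofB]; push_cast; ring_nf

theorem ofC_pow (r : R) (n : ℕ) : ofC r ^ n = ofC (n * r) := by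
  induction n with
  | zero => ext <;> simp [ofC]
  | succ n ih => rw [pow_succ, ih, ofC_mul_ofC]; push_cast; ring_nf

theorem ofA_pow_char (p : ℕ) [CharP R p] (r : R) : ofA r ^ p = 1 := by
  rw [ofA_pow]; ext <;> simp [ofA]

theorem ofB_pow_char (p : ℕ) [CharP R p] (r : R) : ofB r ^ p = 1 := by
  rw [ofB_pow]; ext <;> simp [ofB]

theorem ofC_pow_char (p : ℕ) [CharP R p] (r : R) : ofC r ^ p = 1 := by
  rw [ofC_pow]; ext <;> simp [ofC]

theorem commute_ofA_ofA (r s : R) : Commute (ofA r) (ofA s) := by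
  ext <;> simp [ofA, add_comm]

theorem commute_ofB_ofB (r s : R) : Commute (ofB r) (ofB s) := by
  ext <;> simp [ofB, add_comm]

theorem commute_ofC (r : R) (x : Heisenberg R) : Commute (ofC r) x := by
  ext <;> simp [ofC, add_comm]

theorem ofB_mul_ofA {r s t : R} (h : r * s = t) : ofB r * ofA s = ofA s * ofB r * ofC t := by
  ext <;> simp [ofA, ofB, ofC, h]

theorem commute_ofB_ofA {r s : R} (h : r * s = 0) : Commute (ofB r) (ofA s) := by
  ext <;> simp [ofA, ofB, h]

end Generators

open DualNumber TrivSqZeroExt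

/-- Eight numerical invariants of a `2`-cocycle on the Heisenberg group over the dual numbers,
which determine its class. -/
noncomputable def cocycleInvariants (K : Type*) [CommRing K] :
    (Heisenberg K[ε] × Heisenberg K[ε] → ℂˣ) →* (Fin 8 → ℂˣ) :=
  MonoidHom.pi ![commutatorPairing (ofA 1) (ofA ε), commutatorPairing (ofB 1) (ofB ε),
    commutatorPairing (ofB ε) (ofA ε),
    commutatorFactor (ofA ε) (ofB 1) (ofC ε) / commutatorFactor (ofA 1) (ofB ε) (ofC ε),
    commutatorPairing (ofC 1) (ofA 1), commutatorPairing (ofC ε) (ofA 1),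
    commutatorPairing (ofB 1) (ofC 1), commutatorPairing (ofB 1) (ofC ε)]

/-- The generic representative of a class of additive `2`-cocycles on the Heisenberg group over
the dual numbers. -/
def polyCocycle {K : Type*} [Field K] (k : Fin 8 → K) (x y : Heisenberg K[ε]) : K :=
  k 0 * (fst x.a * snd y.a) + k 1 * (fst x.b * snd y.b) + k 2 * (snd x.b * snd y.a) +
  (k 3 + 2⁻¹ * (k 5 + k 7)) * (fst x.b * snd y.a) +
  k 4 * (fst x.c * fst y.a + 2⁻¹ * (fst x.b * fst y.a ^ 2)) +
  k 5 * (fst x.c * snd y.a + snd x.c * fst y.a +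
    2⁻¹ * (snd x.b * fst y.a ^ 2 + 2 * (fst x.b * fst y.a * snd y.a))) +
  k 6 * (fst x.b * fst y.c + 2⁻¹ * (fst x.b ^ 2 * fst y.a)) +
  k 7 * (fst x.b * snd y.c + snd x.b * fst y.c +
    2⁻¹ * (fst x.b ^ 2 * snd y.a + 2 * (fst x.b * snd x.b * fst y.a)))

section PolyCocycle

variable {K : Type*} [Field K]

theorem polyCocycle_one (k : Fin 8 → K) : polyCocycle k 1 1 = 0 := by simp [polyCocycle]

theorem polyCocycle_add (k l : Fin 8 → K) (x y : Heisenberg K[ε]) :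
    polyCocycle (k + l) x y = polyCocycle k x y + polyCocycle l x y := by
  simp only [polyCocycle, Pi.add_apply]; ring

theorem polyCocycle_cocycle (h2 : (2 : K) ≠ 0) (k : Fin 8 → K) (x y z : Heisenberg K[ε]) :
    polyCocycle k x y + polyCocycle k (x * y) z =
      polyCocycle k x (y * z) + polyCocycle k y z := by
  have h : (2 : K) * 2⁻¹ = 1 := mul_inv_cancel₀ h2
  simp only [polyCocycle, mul_a, mul_b, mul_c, fst_add, snd_add, fst_mul, DualNumber.snd_mul]
  generalize (2 : K)⁻¹ = c at h
  linear_combination (-k 4 * fst x.b * fst y.a * fst z.a -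
    k 5 * (snd x.b * fst y.a * fst z.a + fst x.b * snd y.a * fst z.a +
      fst x.b * fst y.a * snd z.a) + k 6 * fst x.b * fst y.b * fst z.a +
    k 7 * (snd x.b * fst y.b * fst z.a + fst x.b * snd y.b * fst z.a +
      fst x.b * fst y.b * snd z.a)) * h

theorem cocycleInvariants_polyCocycle (h2 : (2 : K) ≠ 0) (χ : Multiplicative K →* ℂˣ)
    (k : Fin 8 → K) (i : Fin 8) :
    cocycleInvariants K (fun q => χ (.ofAdd (polyCocycle k q.1 q.2))) i = χ (.ofAdd (k i)) := by
  have h : (2 : K) * 2⁻¹ = 1 := mul_inv_cancel₀ h2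
  fin_cases i <;>
  simp [cocycleInvariants, commutatorPairing, commutatorFactor, polyCocycle, ofA, ofB, ofC]
  simp only [← map_mul, ← map_inv, ← _root_.map_div, ← ofAdd_add, ← ofAdd_neg, ← ofAdd_sub]
  congr 2
  linear_combination k 7 * h

end PolyCocycle

open CocycleExtension

variable {p : ℕ} [Fact p.Prime]

instance : CharP (ZMod p)[ε] p :=
  charP_of_injective_algebraMap (algebraMap (ZMod p) (ZMod p)[ε]).injective p

theorem cocycleInvariants_coboundary (α : mul2Cocycles (Heisenberg (ZMod p)[ε]))
    (hα : IsMul2Coboundary α.1) : cocycleInvariants (ZMod p) α.1 = 1 := by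
  ext1 i
  fin_cases i
  · exact commutatorPairing_coboundary hα (commute_ofA_ofA _ _)
  · exact commutatorPairing_coboundary hα (commute_ofB_ofB _ _)
  · exact commutatorPairing_coboundary hα (commute_ofB_ofA eps_mul_eps)
  · obtain ⟨f, -, hf⟩ := hα
    change commutatorFactor _ _ _ α.1 / commutatorFactor _ _ _ α.1 = 1
    rw [commutatorFactor_coboundary hf (ofB_mul_ofA (one_mul _)),
      commutatorFactor_coboundary hf (ofB_mul_ofA (mul_one _)), div_self']
  · exact commutatorPairing_coboundary hα (commute_ofC _ _)
  · exact commutatorPairing_coboundary hα (commute_ofC _ _)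
  · exact commutatorPairing_coboundary hα (commute_ofC _ _).symm
  · exact commutatorPairing_coboundary hα (commute_ofC _ _).symm

theorem commutatorFactor_div_pow_eq_one (α : mul2Cocycles (Heisenberg (ZMod p)[ε])) :
    (commutatorFactor (ofA ε) (ofB 1) (ofC ε) α.1 /
      commutatorFactor (ofA 1) (ofB ε) (ofC ε) α.1) ^ p = 1 := by
  have hp : 0 < p := (Fact.out : p.Prime).pos
  obtain ⟨A₀, hA₀, -⟩ := exists_lift α hp (ofA_pow_char p (1 : (ZMod p)[ε]))
  obtain ⟨A₁, hA₁, hA₁p⟩ := exists_lift α hp (ofA_pow_char p (ε : (ZMod p)[ε]))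
  obtain ⟨B₀, hB₀, -⟩ := exists_lift α hp (ofB_pow_char p (1 : (ZMod p)[ε]))
  obtain ⟨B₁, hB₁, hB₁p⟩ := exists_lift α hp (ofB_pow_char p (ε : (ZMod p)[ε]))
  have h01 := mul_eq_mul_mul_incl_mul (x := A₁) (y := B₀) (c := ofC ε)
    (by rw [hA₁, hB₀]; exact ofB_mul_ofA (one_mul _))
  have h10 := mul_eq_mul_mul_incl_mul (x := A₀) (y := B₁) (c := ofC ε)
    (by rw [hA₀, hB₁]; exact ofB_mul_ofA (mul_one _))
  have hA₁B₁ : Commute B₁.base A₁.base := by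
    rw [hA₁, hB₁]; exact commute_ofB_ofA eps_mul_eps
  rw [hA₁, hB₀] at h01
  rw [hA₀, hB₁] at h10
  set u := commutatorFactor (ofA ε) (ofB 1) (ofC ε) α.1
  set v := commutatorFactor (ofA 1) (ofB ε) (ofC ε) α.1
  set C : CocycleExtension α := incl α u * ⟨ofC ε, 1⟩ with hC
  set D : CocycleExtension α := incl α v * ⟨ofC ε, 1⟩ with hD
  have hCb : C.base = ofC ε := by simp [hC]
  have hDb : D.base = ofC ε := by simp [hD]
  have hCA : Commute A₁ D := commute_commutator h10 hA₁B₁.symm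
    (by rw [hA₁, hA₀]; exact commute_ofA_ofA _ _)
  have hDB : Commute B₁ C := commute_commutator h01
    (by rw [hB₁, hB₀]; exact commute_ofB_ofB _ _) hA₁B₁
  have hCD : C = incl α (u / v) * D := by
    rw [hC, hD, ← mul_assoc, ← map_mul, div_mul_cancel]
  have hCA' : Commute C A₁ := by
    rw [hCD]; exact (incl_commute _ _).mul_left hCA.symm
  have hDB' : Commute D⁻¹ B₁ := by
    have : D = (incl α (u / v))⁻¹ * C := by rw [hCD, inv_mul_cancel_left]
    rw [this]
    exact ((incl_commute _ _).inv_left.mul_left hDB.symm).inv_left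
  have hCp : C ^ p = 1 := by
    refine pow_eq_one_of_mul_eq_of_central h01 hCA'
      (mul_eq_mul_mul_incl (by rw [hCb]; exact (commute_ofC _ _).symm)) (incl_commute _) ?_
      (by rw [hA₁p]; exact Commute.one_left _)
    rw [← map_pow, commutatorPairing_pow_eq_one α (by rw [hCb]; exact (commute_ofC _ _).symm)
      (by rw [hCb, ofC_pow_char]), map_one]
  have hDp : (D⁻¹) ^ p = 1 := by
    refine pow_eq_one_of_mul_eq_of_central (x := B₁) (y := A₀) (by rw [h10]; group) hDB'
      (mul_eq_mul_mul_incl (by rw [inv_base, hDb]; exact (commute_ofC _ _).symm.inv_right))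
      (incl_commute _) ?_ (by rw [hB₁p]; exact Commute.one_left _)
    rw [← map_pow, commutatorPairing_pow_eq_one α
      (by rw [inv_base, hDb]; exact (commute_ofC _ _).symm.inv_right)
      (by rw [inv_base, hDb, inv_pow, ofC_pow_char, inv_one]), map_one]
  rw [inv_pow, inv_eq_one] at hDp
  rw [hCD, (incl_commute _ _).mul_pow, hDp, mul_one, ← map_pow] at hCp
  exact incl_injective (hCp.trans (map_one _).symm)

theorem cocycleInvariants_pow_eq_one (α : mul2Cocycles (Heisenberg (ZMod p)[ε])) (i : Fin 8) :
    cocycleInvariants (ZMod p) α.1 i ^ p = 1 := by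
  fin_cases i
  · exact commutatorPairing_pow_eq_one α (commute_ofA_ofA _ _) (ofA_pow_char p _)
  · exact commutatorPairing_pow_eq_one α (commute_ofB_ofB _ _) (ofB_pow_char p _)
  · exact commutatorPairing_pow_eq_one α (commute_ofB_ofA eps_mul_eps) (ofA_pow_char p _)
  · exact commutatorFactor_div_pow_eq_one α
  · exact commutatorPairing_pow_eq_one α (commute_ofC _ _) (ofA_pow_char p _)
  · exact commutatorPairing_pow_eq_one α (commute_ofC _ _) (ofA_pow_char p _)
  · exact commutatorPairing_pow_eq_one α (commute_ofC _ _).symm (ofC_pow_char p _)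
  · exact commutatorPairing_pow_eq_one α (commute_ofC _ _).symm (ofC_pow_char p _)

theorem isMul2Coboundary_of_cocycleInvariants_eq_one
    (α : mul2Cocycles (Heisenberg (ZMod p)[ε])) (h : cocycleInvariants (ZMod p) α.1 = 1) :
    IsMul2Coboundary α.1 := by
  have hp : 0 < p := (Fact.out : p.Prime).pos
  obtain ⟨A₀, hA₀, hA₀p⟩ := exists_lift α hp (ofA_pow_char p (1 : (ZMod p)[ε]))
  obtain ⟨A₁, hA₁, hA₁p⟩ := exists_lift α hp (ofA_pow_char p (ε : (ZMod p)[ε]))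
  obtain ⟨B₀, hB₀, hB₀p⟩ := exists_lift α hp (ofB_pow_char p (1 : (ZMod p)[ε]))
  obtain ⟨B₁, hB₁, hB₁p⟩ := exists_lift α hp (ofB_pow_char p (ε : (ZMod p)[ε]))
  have h00 := mul_eq_mul_mul_incl_mul (x := A₀) (y := B₀) (c := ofC 1)
    (by rw [hA₀, hB₀]; exact ofB_mul_ofA (one_mul _))
  have h01 := mul_eq_mul_mul_incl_mul (x := A₁) (y := B₀) (c := ofC ε)
    (by rw [hA₁, hB₀]; exact ofB_mul_ofA (one_mul _))
  have h10 := mul_eq_mul_mul_incl_mul (x := A₀) (y := B₁) (c := ofC ε)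
    (by rw [hA₀, hB₁]; exact ofB_mul_ofA (mul_one _))
  have hfactor : commutatorFactor (ofA ε) (ofB 1) (ofC ε) α.1 =
      commutatorFactor (ofA 1) (ofB ε) (ofC ε) α.1 := div_eq_one.1 (congrFun h 3)
  rw [hA₁, hB₀, hfactor] at h01
  rw [hA₀, hB₁] at h10
  set C₀ : CocycleExtension α := incl α _ * ⟨ofC 1, 1⟩ with hC₀
  set C₁ : CocycleExtension α := incl α _ * ⟨ofC ε, 1⟩ with hC₁
  have hC₀b : C₀.base = ofC 1 := by simp [hC₀]
  have hC₁b : C₁.base = ofC ε := by simp [hC₁]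
  have comm {x y : CocycleExtension α} {r s : Heisenberg (ZMod p)[ε]} (hx : x.base = r)
      (hy : y.base = s) (hrs : Commute r s) (h1 : commutatorPairing r s α.1 = 1) :
      Commute x y := by
    subst hx hy
    exact commute_of_commutatorPairing_eq_one hrs h1
  have hAA : Commute A₀ A₁ := comm hA₀ hA₁ (commute_ofA_ofA _ _) (congrFun h 0)
  have hBB : Commute B₀ B₁ := comm hB₀ hB₁ (commute_ofB_ofB _ _) (congrFun h 1)
  have h11 : Commute B₁ A₁ := comm hB₁ hA₁ (commute_ofB_ofA eps_mul_eps) (congrFun h 2)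
  have hC₀A₀ : Commute C₀ A₀ := comm hC₀b hA₀ (commute_ofC _ _) (congrFun h 4)
  have hC₁A₀ : Commute C₁ A₀ := comm hC₁b hA₀ (commute_ofC _ _) (congrFun h 5)
  have hB₀C₀ : Commute B₀ C₀ := comm hB₀ hC₀b (commute_ofC _ _).symm (congrFun h 6)
  have hB₀C₁ : Commute B₀ C₁ := comm hB₀ hC₁b (commute_ofC _ _).symm (congrFun h 7)
  have hA₁C₁ : Commute A₁ C₁ := commute_of_mul_eq_mul_mul (u := 1) (v := 1) h10
    (by rw [h11.eq, mul_one]) (by rw [hAA.eq, mul_one])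
    (.one_left _) (.one_left _) (.one_left _) (.one_left _) (.one_left _) (.one_left _)
    (.one_left _)
  have hB₁C₁ : Commute B₁ C₁ := commute_of_mul_eq_mul_mul (u := 1) (v := 1) h01
    (by rw [hBB.eq, mul_one]) (by rw [h11.eq, mul_one])
    (.one_left _) (.one_left _) (.one_left _) (.one_left _) (.one_left _) (.one_left _)
    (.one_left _)
  have hA₁C₀ : Commute A₁ C₀ := commute_of_mul_eq_mul_mul (u := C₁⁻¹) (v := 1) h00
    (by rw [h01, mul_inv_cancel_right]) (by rw [hAA.eq, mul_one])
    hA₁C₁.symm.inv_left hB₀C₁.symm.inv_left hC₁A₀.inv_left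
    (.one_left _) (.one_left _) (.one_left _) (.one_right _)
  have hB₁C₀ : Commute B₁ C₀ := commute_of_mul_eq_mul_mul (u := 1) (v := C₁) h00
    (by rw [hBB.eq, mul_one]) h10
    (.one_left _) (.one_left _) (.one_left _)
    hB₁C₁.symm hB₀C₁.symm hC₁A₀ (.one_left _)
  obtain ⟨σ, hσ⟩ := exists_heisenberg_dualNumber_hom hA₀p hA₁p hB₀p hB₁p hAA.symm hBB.symm h11
    h00 h01 h10 hC₀A₀ hA₁C₀.symm hB₀C₀.symm hB₁C₀.symm hC₁A₀ hA₁C₁.symm hB₀C₁.symm hB₁C₁.symm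
  refine isMul2Coboundary_of_section σ fun x => ?_
  simp only [hσ, mul_base, pow_base, hA₀, hA₁, hB₀, hB₁, hC₀b, hC₁b, ofA_pow, ofB_pow, ofC_pow,
    ofA_mul_ofA, ofB_mul_ofB, ofC_mul_ofC]
  ext <;> simp [ofA, ofB, ofC, -ZMod.natCast_val, ZMod.natCast_zmod_val]

/-- The polynomial cocycle with parameters `k`, composed with a character of `ZMod p`. -/
def polyMul2Cocycle (h2 : (2 : ZMod p) ≠ 0) (χ : Multiplicative (ZMod p) →* ℂˣ) :
    Multiplicative (Fin 8 → ZMod p) →* mul2Cocycles (Heisenberg (ZMod p)[ε]) where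
  toFun k := ⟨fun q => χ (.ofAdd (polyCocycle k.toAdd q.1 q.2)),
    isMul2Cocycle_comp χ (polyCocycle_one _) (polyCocycle_cocycle h2 _)⟩
  map_one' := by
    ext1; funext q
    simp [polyCocycle]
  map_mul' k l := by
    ext1; funext q
    simp [polyCocycle_add]

theorem exists_zmod_character (p : ℕ) [NeZero p] : ∃ χ : Multiplicative (ZMod p) →* ℂˣ,
    Function.Injective χ ∧ ∀ u : ℂˣ, u ^ p = 1 → ∃ m, χ m = u := by
  obtain ⟨ζ, hζ⟩ : ∃ ζ : ℂˣ, IsPrimitiveRoot ζ p :=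
    ⟨_, (Complex.isPrimitiveRoot_exp p (NeZero.ne p)).isUnit_unit (NeZero.ne p)⟩
  refine ⟨(Subgroup.zpowers ζ).subtype.comp
    (AddMonoidHom.toMultiplicativeLeft hζ.zmodEquivZPowers.toAddMonoidHom), ?_, fun u hu => ?_⟩
  · exact Subtype.val_injective.comp hζ.zmodEquivZPowers.injective
  · have hu' : u ∈ Subgroup.zpowers ζ := by rw [hζ.zpowers_eq]; exact hu
    obtain ⟨m, hm⟩ := hζ.zmodEquivZPowers.surjective (.ofMul ⟨u, hu'⟩)
    exact ⟨.ofAdd m, congrArg Subtype.val hm⟩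

theorem nonempty_schurMultiplier_dualNumber (h2 : (2 : ZMod p) ≠ 0) :
    Nonempty (Multiplicative (Fin 8 → ZMod p) ≃* SchurMultiplier (Heisenberg (ZMod p)[ε])) := by
  obtain ⟨χ, hχ, hχ'⟩ := exists_zmod_character p
  refine ⟨MulEquiv.ofBijective
    ((QuotientGroup.mk' _).comp (polyMul2Cocycle h2 χ)) ⟨?_, ?_⟩⟩
  · rw [injective_iff_map_eq_one]
    intro k hk
    have h1 : IsMul2Coboundary (polyMul2Cocycle h2 χ k).1 :=
      Subgroup.mem_subgroupOf.1 ((QuotientGroup.eq_one_iff _).1 hk)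
    have hone := cocycleInvariants_coboundary _ h1
    apply Multiplicative.toAdd.injective
    funext i
    have h3 := (cocycleInvariants_polyCocycle h2 χ k.toAdd i).symm.trans (congrFun hone i)
    exact hχ (h3.trans (map_one χ).symm)
  · intro q
    obtain ⟨α, rfl⟩ := QuotientGroup.mk_surjective q
    choose k hk using fun i => hχ' _ (cocycleInvariants_pow_eq_one α i)
    refine ⟨.ofAdd fun i => (k i).toAdd, ?_⟩
    refine QuotientGroup.eq.2 (Subgroup.mem_subgroupOf.2 ?_)
    refine isMul2Coboundary_of_cocycleInvariants_eq_one _ ?_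
    rw [Subgroup.coe_mul, Subgroup.coe_inv, map_mul, map_inv, inv_mul_eq_one]
    funext i
    exact (cocycleInvariants_polyCocycle h2 χ _ i).trans (hk i)

end Heisenberg

/-- The Schur multiplier of the Heisenberg group over `𝔽_p[t]/(t²)`, for `p` an odd
prime, is isomorphic as an abelian group to `(ℤ/pℤ)⁸`. -/
theorem schurMultiplier_heisenberg_dual_numbers (p : ℕ) [Fact p.Prime] (hodd : Odd p) :
    Nonempty
      (SchurMultiplier (Heisenberg ((ZMod p)[X] ⧸ Ideal.span {(X : (ZMod p)[X]) ^ 2})) ≃*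
        Multiplicative (Fin 8 → ZMod p)) := by
  have h2 : (2 : ZMod p) ≠ 0 := by
    intro h
    have h' : p ∣ 2 := (ZMod.natCast_eq_zero_iff 2 p).1 (by exact_mod_cast h)
    rcases (Nat.dvd_prime Nat.prime_two).1 h' with rfl | rfl
    · exact (Fact.out : Nat.Prime 1).ne_one rfl
    · exact absurd hodd (by decide)
  obtain ⟨e⟩ := Heisenberg.nonempty_schurMultiplier_dualNumber h2
  exact ⟨(schurMultiplierCongr
    (Heisenberg.congr (quotientXSqEquivDualNumber (ZMod p)).toRingEquiv)).trans e.symm⟩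
end

section
/- Let p be an odd prime. Then the Schur multiplier H²(H₃(𝔽_{p²}), ℂˣ) of the Heisenberg group over the field 𝔽_{p²} with p² elements is isomorphic as an abelian group to (ℤ/pℤ)⁸. -/
section CentralExtension

open scoped commutatorElement

section

variable {E : Type*} [Group E]

lemma commutatorElement_mul_left_of_central (hc : ∀ x y z : E, Commute ⁅x, y⁆ z) (x y z : E) :
    ⁅x * y, z⁆ = ⁅x, z⁆ * ⁅y, z⁆ := by
  rw [commutatorElement_mul_left_eq_conj_mul, ← (hc y z x).eq, mul_inv_cancel_right,
    (hc y z _).eq]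

lemma commutatorElement_mul_right_of_central (hc : ∀ x y z : E, Commute ⁅x, y⁆ z) (x y z : E) :
    ⁅x, y * z⁆ = ⁅x, y⁆ * ⁅x, z⁆ := by
  rw [commutatorElement_mul_right_eq_mul_conj, mul_assoc _ y, ← (hc x z y).eq, ← mul_assoc,
    mul_inv_cancel_right]

end

section

variable {S M : Type*} [AddCommGroup M]

/-- The defect of symmetry of `α`; on commuting elements it is the commutator of their lifts to
the central extension attached to `α`. -/
def commPairing (α : S → S → M) (x y : S) : M := α x y - α y x

lemma commPairing_sub (α β : S → S → M) (x y : S) :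
    commPairing (α - β) x y = commPairing α x y - commPairing β x y := by
  simp only [commPairing, Pi.sub_apply]; abel

lemma commPairing_swap (α : S → S → M) (x y : S) : commPairing α y x = -commPairing α x y := by
  simp only [commPairing]; abel

lemma commPairing_self (α : S → S → M) (x : S) : commPairing α x x = 0 := sub_self _

end

variable {G M : Type*} [Group G] [AddCommGroup M]

/-- Normalized `2`-cocycles of `G` with values in an additive group `M` (trivial action). -/
structure IsAdd2Cocycle (α : G → G → M) : Prop where
  map_one_one : α 1 1 = 0
  add_eq : ∀ x y z, α x y + α (x * y) z = α x (y * z) + α y z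

/-- The `M`-component of the commutator of the standard lifts of `x` and `y` to the central
extension attached to `α`. -/
def liftCommutator (α : G → G → M) (x y : G) : M := α x y - α y x - α ⁅x, y⁆ (y * x)

lemma liftCommutator_sub (α β : G → G → M) (x y : G) :
    liftCommutator (α - β) x y = liftCommutator α x y - liftCommutator β x y := by
  simp only [liftCommutator, Pi.sub_apply]; abel

namespace IsAdd2Cocycle

variable {α β : G → G → M}

lemma sub (hα : IsAdd2Cocycle α) (hβ : IsAdd2Cocycle β) : IsAdd2Cocycle (α - β) where
  map_one_one := by simp [hα.map_one_one, hβ.map_one_one]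
  add_eq x y z := by
    have h₁ := hα.add_eq x y z
    have h₂ := hβ.add_eq x y z
    simp only [Pi.sub_apply]
    rw [sub_add_sub_comm, sub_add_sub_comm, h₁, h₂]

lemma map_one_left (hα : IsAdd2Cocycle α) (x : G) : α 1 x = 0 := by
  have h := hα.add_eq 1 1 x
  rw [one_mul, one_mul, hα.map_one_one, zero_add] at h
  exact left_eq_add.mp h

lemma map_one_right (hα : IsAdd2Cocycle α) (x : G) : α x 1 = 0 := by
  have h := hα.add_eq x 1 1
  rw [mul_one, mul_one, hα.map_one_one, add_zero] at h
  exact left_eq_add.mp h.symm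

lemma commPairing_mul_right (hα : IsAdd2Cocycle α) {x y z : G} (hy : Commute x y)
    (hz : Commute x z) : commPairing α x (y * z) = commPairing α x y + commPairing α x z := by
  have h₁ := hα.add_eq x y z
  have h₂ := hα.add_eq y z x
  have h₃ := hα.add_eq y x z
  rw [← hz.eq] at h₂
  rw [← hy.eq] at h₃
  simp only [commPairing]
  grind

lemma commPairing_mul_left (hα : IsAdd2Cocycle α) {x y z : G} (hy : Commute x y)
    (hz : Commute x z) : commPairing α (y * z) x = commPairing α y x + commPairing α z x := by
  rw [commPairing_swap, hα.commPairing_mul_right hy hz, commPairing_swap α y,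
    commPairing_swap α z]
  abel

/-- The central extension of `G` by `M` attached to a `2`-cocycle. -/
@[ext]
structure Extension (hα : IsAdd2Cocycle α) where
  val : M
  base : G

namespace Extension

variable {hα : IsAdd2Cocycle α}

instance : Mul hα.Extension := ⟨fun X Y => ⟨X.val + Y.val + α X.base Y.base, X.base * Y.base⟩⟩

instance : One hα.Extension := ⟨⟨0, 1⟩⟩

instance : Inv hα.Extension := ⟨fun X => ⟨-X.val - α X.base⁻¹ X.base, X.base⁻¹⟩⟩

@[simp] lemma mul_val (X Y : hα.Extension) :
    (X * Y).val = X.val + Y.val + α X.base Y.base := rfl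
@[simp] lemma mul_base (X Y : hα.Extension) : (X * Y).base = X.base * Y.base := rfl
@[simp] lemma one_val : (1 : hα.Extension).val = 0 := rfl
@[simp] lemma one_base : (1 : hα.Extension).base = 1 := rfl
@[simp] lemma inv_base (X : hα.Extension) : X⁻¹.base = X.base⁻¹ := rfl
@[simp] lemma inv_val (X : hα.Extension) : X⁻¹.val = -X.val - α X.base⁻¹ X.base := rfl

instance : Group hα.Extension where
  mul_assoc X Y Z := by
    ext
    · have h := hα.add_eq X.base Y.base Z.base
      simp only [mul_val, mul_base]
      grind
    · simp [mul_assoc]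
  one_mul X := by ext <;> simp [hα.map_one_left]
  mul_one X := by ext <;> simp [hα.map_one_right]
  inv_mul_cancel X := by
    ext
    · simp only [mul_val, inv_val, inv_base, one_val]; abel
    · simp

lemma base_commutatorElement (X Y : hα.Extension) : ⁅X, Y⁆.base = ⁅X.base, Y.base⁆ := by
  simp [commutatorElement_def]

lemma commutatorElement_eq (X Y : hα.Extension) :
    ⁅X, Y⁆ = ⟨liftCommutator α X.base Y.base, ⁅X.base, Y.base⁆⟩ := by
  rw [commutatorElement_def, mul_inv_eq_iff_eq_mul, mul_inv_eq_iff_eq_mul, mul_assoc]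
  ext
  · simp only [mul_val, mul_base, liftCommutator]; abel
  · simp [commutatorElement_def]

lemma mul_eq_of_commute (X Y : hα.Extension) (h : Commute X.base Y.base) :
    X * Y = ⟨commPairing α X.base Y.base, 1⟩ * (Y * X) := by
  ext
  · simp only [mul_val, mul_base, commPairing, hα.map_one_left]; abel
  · simp [h.eq]

lemma commute_val (m : M) (X : hα.Extension) : Commute (⟨m, 1⟩ : hα.Extension) X := by
  ext
  · simp only [mul_val, hα.map_one_left, hα.map_one_right]; abel
  · simp

end Extension

lemma commPairing_conj (hα : IsAdd2Cocycle α) {x y : G} (h : Commute x y) (g : G) :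
    commPairing α (g * x * g⁻¹) (g * y * g⁻¹) = commPairing α x y := by
  let X : hα.Extension := ⟨0, x⟩
  let Y : hα.Extension := ⟨0, y⟩
  let K : hα.Extension := ⟨0, g⟩
  have h₁ := Extension.mul_eq_of_commute X Y h
  have h₂ := Extension.mul_eq_of_commute (K * X * K⁻¹) (K * Y * K⁻¹)
    (by simpa using h.map (MulAut.conj g))
  have h₃ : K * X * K⁻¹ * (K * Y * K⁻¹) =
      ⟨commPairing α x y, 1⟩ * (K * Y * K⁻¹ * (K * X * K⁻¹)) := by
    calc _ = K * (X * Y) * K⁻¹ := by group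
      _ = K * (⟨commPairing α x y, 1⟩ * (Y * X)) * K⁻¹ := by rw [h₁]
      _ = ⟨commPairing α x y, 1⟩ * (K * (Y * X) * K⁻¹) := by
        rw [← mul_assoc K, ← (Extension.commute_val _ K).eq]; group
      _ = _ := by group
  exact congrArg Extension.val (mul_right_cancel (h₂.symm.trans h₃))

/-- A cocycle with values in a divisible group is a coboundary as soon as no nontrivial element
of `M` is a product of commutators in the attached central extension. -/
theorem exists_eq_of_commutator [DivisibleBy M ℤ] (hα : IsAdd2Cocycle α)
    (h : ∀ m : M, (⟨m, 1⟩ : hα.Extension) ∈ commutator hα.Extension → m = 0) :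
    ∃ f : G → M, f 1 = 0 ∧ ∀ x y, α x y = f x + f y - f (x * y) := by
  let ι : M →+ Additive (Abelianization hα.Extension) :=
    { toFun := fun m => Additive.ofMul (Abelianization.of ⟨m, 1⟩)
      map_zero' := by
        rw [show (⟨0, 1⟩ : hα.Extension) = 1 from rfl, map_one, ofMul_one]
      map_add' := fun m n => by
        rw [← ofMul_mul, ← map_mul]
        congr 2
        ext <;> simp [hα.map_one_one] }
  have hι : Function.Injective ι := by
    rw [injective_iff_map_eq_zero]
    intro m hm
    refine h m ?_
    rw [← Abelianization.ker_of, MonoidHom.mem_ker]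
    exact hm
  obtain ⟨r, hr⟩ := (Module.Baer.of_divisible M).extension_property_addMonoidHom ι hι
    (AddMonoidHom.id M)
  let s : G → Additive (Abelianization hα.Extension) :=
    fun x => Additive.ofMul (Abelianization.of ⟨0, x⟩)
  have hs (x y : G) : s x + s y = ι (α x y) + s (x * y) := by
    simp only [s, ι, AddMonoidHom.coe_mk, ZeroHom.coe_mk]
    rw [← ofMul_mul, ← map_mul, ← ofMul_mul, ← map_mul]
    congr 2
    ext <;> simp [hα.map_one_left]
  refine ⟨fun x => r (s x), ?_, fun x y => ?_⟩
  · have : s 1 = 0 := by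
      simp only [s]
      rw [show (⟨0, 1⟩ : hα.Extension) = 1 from rfl, map_one, ofMul_one]
    simp [this]
  · have h₁ := congrArg r (hs x y)
    have h₂ : r (ι (α x y)) = α x y := DFunLike.congr_fun hr _
    rw [map_add, map_add, h₂] at h₁
    exact eq_sub_of_add_eq h₁.symm

/-- If all commutators of the attached extension are central, `liftCommutator` is additive in the
first variable up to the cocycle itself. -/
lemma liftCommutator_mul_left (hα : IsAdd2Cocycle α)
    (hc : ∀ X Y Z : hα.Extension, Commute ⁅X, Y⁆ Z) (x x' y : G) :
    liftCommutator α (x * x') y =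
      liftCommutator α x y + liftCommutator α x' y + α ⁅x, y⁆ ⁅x', y⁆ := by
  let X : hα.Extension := ⟨0, x⟩
  let X' : hα.Extension := ⟨0, x'⟩
  let Y : hα.Extension := ⟨0, y⟩
  have h := commutatorElement_mul_left_of_central hc X X' Y
  simpa only [Extension.commutatorElement_eq, Extension.mul_val, Extension.mul_base, X, X', Y]
    using congrArg Extension.val h

lemma liftCommutator_mul_right (hα : IsAdd2Cocycle α)
    (hc : ∀ X Y Z : hα.Extension, Commute ⁅X, Y⁆ Z) (x y y' : G) :
    liftCommutator α x (y * y') =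
      liftCommutator α x y + liftCommutator α x y' + α ⁅x, y⁆ ⁅x, y'⁆ := by
  let X : hα.Extension := ⟨0, x⟩
  let Y : hα.Extension := ⟨0, y⟩
  let Y' : hα.Extension := ⟨0, y'⟩
  have h := commutatorElement_mul_right_of_central hc X Y Y'
  simpa only [Extension.commutatorElement_eq, Extension.mul_val, Extension.mul_base, X, Y, Y']
    using congrArg Extension.val h

end IsAdd2Cocycle

end CentralExtension
namespace Heisenberg

open scoped commutatorElement

section Generators

variable {R : Type*} [CommRing R]

/-- The elementary matrix with (2,3)-entry `a`. -/
def elemA (a : R) : Heisenberg R := ⟨a, 0, 0⟩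

/-- The elementary matrix with (1,2)-entry `b`. -/
def elemB (b : R) : Heisenberg R := ⟨0, b, 0⟩

/-- The elementary matrix with (1,3)-entry `c`. -/
def elemZ (c : R) : Heisenberg R := ⟨0, 0, c⟩

lemma elemA_add (a a' : R) : elemA (a + a') = elemA a * elemA a' := by ext <;> simp [elemA]

lemma elemB_add (b b' : R) : elemB (b + b') = elemB b * elemB b' := by ext <;> simp [elemB]

lemma elemZ_add (c c' : R) : elemZ (c + c') = elemZ c * elemZ c' := by ext <;> simp [elemZ]

lemma commute_elemA (a a' : R) : Commute (elemA a) (elemA a') := by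
  ext <;> simp [elemA, add_comm]

lemma commute_elemB (b b' : R) : Commute (elemB b) (elemB b') := by
  ext <;> simp [elemB, add_comm]

lemma commute_elemZ (c : R) (x : Heisenberg R) : Commute (elemZ c) x := by
  ext <;> simp [elemZ, add_comm]

lemma eq_mul_elem (x : Heisenberg R) : x = elemA x.a * elemB x.b * elemZ x.c := by
  ext <;> simp [elemA, elemB, elemZ]

lemma commutatorElement_eq (x y : Heisenberg R) : ⁅x, y⁆ = elemZ (x.b * y.a - y.b * x.a) := by
  rw [commutatorElement_def, mul_inv_eq_iff_eq_mul, mul_inv_eq_iff_eq_mul]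
  ext <;> simp [elemZ] <;> ring

lemma commutatorElement_elemB_elemA (b a : R) : ⁅elemB b, elemA a⁆ = elemZ (b * a) := by
  simp [commutatorElement_eq, elemA, elemB]

end Generators

section Invariants

variable {R M : Type*} [CommRing R] [AddCommGroup M] {α : Heisenberg R → Heisenberg R → M}

/-- If conjugations act on a family `X` by shears into the centre, then the commutator pairing of
`X` with the centre is symmetric and the centre pairs trivially with itself. -/
lemma commPairing_of_shear (hα : IsAdd2Cocycle α) {X : R → Heisenberg R}
    (hX : ∀ a a', Commute (X a) (X a'))
    (hconj : ∀ b, ∃ g, ∀ a, g * X a * g⁻¹ = X a * elemZ (b * a)) :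
    (∀ z z', commPairing α (elemZ z) (elemZ z') = 0) ∧
      ∀ a z, commPairing α (X a) (elemZ z) = commPairing α (X 1) (elemZ (z * a)) := by
  have hZ : ∀ z z', commPairing α (elemZ z) (elemZ z') = 0 := by
    intro z z'
    obtain ⟨g, hg⟩ := hconj z
    have h := hα.commPairing_conj (commute_elemZ z' (X 1)).symm g
    rw [hg, ← (commute_elemZ z' g).eq, mul_inv_cancel_right, mul_one,
      hα.commPairing_mul_left (commute_elemZ _ _) (commute_elemZ _ _)] at h
    exact left_eq_add.mp h.symm
  refine ⟨hZ, fun a z => ?_⟩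
  obtain ⟨g, hg⟩ := hconj z
  have h := hα.commPairing_conj (hX a 1) g
  have hc : ∀ c x, Commute x (elemZ (R := R) c) := fun c x => (commute_elemZ c x).symm
  rw [hg, hg, hα.commPairing_mul_right ((hX a 1).mul_left (commute_elemZ _ _)) (hc _ _),
    hα.commPairing_mul_left (hX 1 a) (hc _ _), hα.commPairing_mul_left (commute_elemZ _ _)
      (commute_elemZ _ _), hZ, commPairing_swap α (X 1) (elemZ (z * a)), mul_one] at h
  grind

lemma exists_conj_elemA (b : R) :
    ∃ g : Heisenberg R, ∀ a, g * elemA a * g⁻¹ = elemA a * elemZ (b * a) :=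
  ⟨elemB b, fun a => by ext <;> simp [elemA, elemB, elemZ]⟩

lemma exists_conj_elemB (a : R) :
    ∃ g : Heisenberg R, ∀ b, g * elemB b * g⁻¹ = elemB b * elemZ (a * b) :=
  ⟨elemA (-a), fun b => by ext <;> simp [elemA, elemB, elemZ, mul_comm]⟩

/-- The commutator pairing of `α` vanishes on all pairs of commuting elementary matrices. -/
structure CommTrivial (α : Heisenberg R → Heisenberg R → M) : Prop where
  elemA_elemA : ∀ a a', commPairing α (elemA a) (elemA a') = 0
  elemB_elemB : ∀ b b', commPairing α (elemB b) (elemB b') = 0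
  elemA_elemZ : ∀ a z, commPairing α (elemA a) (elemZ z) = 0
  elemB_elemZ : ∀ b z, commPairing α (elemB b) (elemZ z) = 0

/-- The failure of `⁅elemB b, elemA a⁆` to depend only on `b * a` in the extension. -/
def mixedDefect (α : Heisenberg R → Heisenberg R → M) (b a : R) : M :=
  liftCommutator α (elemB b) (elemA a) - liftCommutator α (elemB 1) (elemA (b * a))

lemma mixedDefect_sub (α β : Heisenberg R → Heisenberg R → M) (b a : R) :
    mixedDefect (α - β) b a = mixedDefect α b a - mixedDefect β b a := by
  simp only [mixedDefect, liftCommutator_sub]; abel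

lemma mixedDefect_one (α : Heisenberg R → Heisenberg R → M) (a : R) : mixedDefect α 1 a = 0 := by
  simp [mixedDefect]

lemma CommTrivial.commPairing_elemZ (hα : IsAdd2Cocycle α) (h : CommTrivial α)
    (x : Heisenberg R) (z : R) : commPairing α (elemZ z) x = 0 := by
  have hZ := (commPairing_of_shear hα commute_elemA exists_conj_elemA).1
  rw [eq_mul_elem x, hα.commPairing_mul_right (commute_elemZ _ _) (commute_elemZ _ _),
    hα.commPairing_mul_right (commute_elemZ _ _) (commute_elemZ _ _), hZ,
    commPairing_swap α (elemA _), commPairing_swap α (elemB _), h.elemA_elemZ, h.elemB_elemZ]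
  simp

lemma CommTrivial.commute_of_base (hα : IsAdd2Cocycle α) (h : CommTrivial α)
    {X : hα.Extension} {z : R} (hX : X.base = elemZ z) (Y : hα.Extension) : Commute X Y := by
  have h₁ := IsAdd2Cocycle.Extension.mul_eq_of_commute X Y (hX ▸ commute_elemZ z Y.base)
  rw [hX, h.commPairing_elemZ hα] at h₁
  exact h₁.trans (one_mul _)

lemma CommTrivial.commute_commutatorElement (hα : IsAdd2Cocycle α) (h : CommTrivial α)
    (X Y Z : hα.Extension) : Commute ⁅X, Y⁆ Z :=
  h.commute_of_base hα ((IsAdd2Cocycle.Extension.base_commutatorElement X Y).trans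
    (commutatorElement_eq _ _)) Z

lemma CommTrivial.mixedDefect_add_left (hα : IsAdd2Cocycle α) (h : CommTrivial α) (b b' a : R) :
    mixedDefect α (b + b') a = mixedDefect α b a + mixedDefect α b' a := by
  have hc := h.commute_commutatorElement hα
  simp only [mixedDefect, elemB_add, add_mul, elemA_add, hα.liftCommutator_mul_left hc,
    hα.liftCommutator_mul_right hc, commutatorElement_elemB_elemA, one_mul]
  abel

lemma CommTrivial.mixedDefect_add_right (hα : IsAdd2Cocycle α) (h : CommTrivial α) (b a a' : R) :
    mixedDefect α b (a + a') = mixedDefect α b a + mixedDefect α b a' := by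
  have hc := h.commute_commutatorElement hα
  simp only [mixedDefect, mul_add, elemA_add, hα.liftCommutator_mul_right hc,
    commutatorElement_elemB_elemA, one_mul]
  abel

/-- A cocycle whose commutator invariants all vanish is a coboundary. -/
theorem CommTrivial.exists_eq [DivisibleBy M ℤ] (hα : IsAdd2Cocycle α) (h : CommTrivial α)
    (hm : ∀ b a, mixedDefect α b a = 0) :
    ∃ f : Heisenberg R → M, f 1 = 0 ∧ ∀ x y, α x y = f x + f y - f (x * y) := by
  refine hα.exists_eq_of_commutator fun m hmem => ?_
  have hc := h.commute_commutatorElement hα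
  let σ : Multiplicative R →* hα.Extension := MonoidHom.mk'
    (fun z => ⟨liftCommutator α (elemB 1) (elemA z.toAdd), elemZ z.toAdd⟩) fun z w => by
      ext1
      · simp [elemA_add, hα.liftCommutator_mul_right hc, commutatorElement_elemB_elemA]
      · simp [elemZ_add]
  have hBA (b a : R) : ⁅(⟨0, elemB b⟩ : hα.Extension), ⟨0, elemA a⟩⁆ ∈ σ.range := by
    refine ⟨Multiplicative.ofAdd (b * a), ?_⟩
    rw [IsAdd2Cocycle.Extension.commutatorElement_eq, commutatorElement_elemB_elemA]
    exact congrArg (IsAdd2Cocycle.Extension.mk · _) (sub_eq_zero.mp (hm b a)).symm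
  have hle : commutator hα.Extension ≤ σ.range := by
    rw [commutator_def, Subgroup.commutator_le]
    rintro X - Y -
    have hml := commutatorElement_mul_left_of_central hc
    have hmr := commutatorElement_mul_right_of_central hc
    have hX : ⁅X, Y⁆ = ⁅(⟨0, elemA X.base.a⟩ * ⟨0, elemB X.base.b⟩ : hα.Extension),
        (⟨0, elemA Y.base.a⟩ * ⟨0, elemB Y.base.b⟩ : hα.Extension)⁆ := by
      have hd (X : hα.Extension) : ∃ W : hα.Extension, (∀ Y, Commute W Y) ∧
          X = W * (⟨0, elemA X.base.a⟩ * ⟨0, elemB X.base.b⟩ : hα.Extension) := by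
        refine ⟨X * (⟨0, elemA X.base.a⟩ * ⟨0, elemB X.base.b⟩ : hα.Extension)⁻¹,
          h.commute_of_base hα (z := X.base.c) ?_, by group⟩
        rw [IsAdd2Cocycle.Extension.mul_base, IsAdd2Cocycle.Extension.inv_base,
          mul_inv_eq_iff_eq_mul, (commute_elemZ _ _).eq]
        exact eq_mul_elem _
      obtain ⟨W, hW, hXW⟩ := hd X
      obtain ⟨V, hV, hYV⟩ := hd Y
      generalize (⟨0, elemA X.base.a⟩ * ⟨0, elemB X.base.b⟩ : hα.Extension) = X' at *
      generalize (⟨0, elemA Y.base.a⟩ * ⟨0, elemB Y.base.b⟩ : hα.Extension) = Y' at *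
      rw [hXW, hYV, hml, hmr X', commutatorElement_eq_one_iff_commute.mpr (hW _),
        commutatorElement_eq_one_iff_commute.mpr (hV _).symm, one_mul, one_mul]
    have hone (X Y : hα.Extension) (hXY : Commute X.base Y.base)
        (h0 : commPairing α X.base Y.base = 0) : ⁅X, Y⁆ = 1 := by
      rw [commutatorElement_eq_one_iff_commute]
      have h₁ := IsAdd2Cocycle.Extension.mul_eq_of_commute X Y hXY
      rw [h0] at h₁
      exact h₁.trans (one_mul _)
    rw [hX, hml, hmr, hmr, hone ⟨0, elemA _⟩ ⟨0, elemA _⟩ (commute_elemA _ _) (h.elemA_elemA _ _),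
      hone ⟨0, elemB _⟩ ⟨0, elemB _⟩ (commute_elemB _ _) (h.elemB_elemB _ _), one_mul, mul_one]
    refine mul_mem ?_ (hBA _ _)
    rw [← commutatorElement_inv]
    exact inv_mem (hBA _ _)
  obtain ⟨z, hz⟩ := hle hmem
  have hz0 : z.toAdd = 0 := congrArg (fun e : hα.Extension => e.base.c) hz
  have : z = 1 := hz0
  rw [this, map_one] at hz
  exact (congrArg IsAdd2Cocycle.Extension.val hz).symm

end Invariants

section PrimeTorsion

variable {p : ℕ} [Fact p.Prime] {F M : Type*} [Field F] [Algebra (ZMod p) F] [AddCommGroup M]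
  (e : Module.Basis (Fin 2) (ZMod p) F) {ζ : ZMod p →+ M}

/-- The linear form on `F` with values `s` and `t` on the basis `e`. -/
noncomputable def form (s t : ZMod p) : F →ₗ[ZMod p] ZMod p := s • e.coord 0 + t • e.coord 1

lemma form_apply (s t : ZMod p) (x : F) :
    form e s t x = s * e.coord 0 x + t * e.coord 1 x := rfl

lemma exists_form_eq (hζ : ∀ m : M, p • m = 0 → ∃ s, ζ s = m) (χ : F →+ M) :
    ∃ s t, ∀ x, χ x = ζ (form e s t x) := by
  have hp (x : F) : p • χ x = 0 := by
    rw [← map_nsmul, ← Nat.cast_smul_eq_nsmul (ZMod p), CharP.cast_eq_zero, zero_smul, map_zero]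
  obtain ⟨s, hs⟩ := hζ _ (hp (e 0))
  obtain ⟨t, ht⟩ := hζ _ (hp (e 1))
  have hsmul (n : ZMod p) (x : F) (s : ZMod p) (h : ζ s = χ x) : χ (n • x) = ζ (s * n) := by
    rw [← ZMod.natCast_zmod_val n, Nat.cast_smul_eq_nsmul, map_nsmul, ← h, ← map_nsmul,
      nsmul_eq_mul, mul_comm]
  refine ⟨s, t, fun x => ?_⟩
  conv_lhs => rw [← e.sum_repr x]
  rw [Fin.sum_univ_two, map_add, hsmul _ _ s hs, hsmul _ _ t ht, form_apply, map_add]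
  rfl

lemma exists_form₂_eq (hζ : ∀ m : M, p • m = 0 → ∃ s, ζ s = m) (B : F →+ F →+ M) :
    ∃ s₀ t₀ s₁ t₁, ∀ x y,
      B x y = ζ (e.coord 0 x * form e s₀ t₀ y + e.coord 1 x * form e s₁ t₁ y) := by
  obtain ⟨s₀, t₀, h₀⟩ := exists_form_eq e hζ (B (e 0))
  obtain ⟨s₁, t₁, h₁⟩ := exists_form_eq e hζ (B (e 1))
  refine ⟨s₀, t₀, s₁, t₁, fun x y => ?_⟩
  have hsmul (n : ZMod p) (x : F) : B (n • x) y = n.val • B x y := by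
    conv_lhs => rw [← ZMod.natCast_zmod_val n]
    rw [Nat.cast_smul_eq_nsmul, map_nsmul, AddMonoidHom.nsmul_apply]
  conv_lhs => rw [← e.sum_repr x]
  rw [Fin.sum_univ_two, map_add, AddMonoidHom.add_apply, hsmul, hsmul, h₀, h₁, ← map_nsmul ζ,
    ← map_nsmul ζ, map_add, nsmul_eq_mul, nsmul_eq_mul, ZMod.natCast_zmod_val,
    ZMod.natCast_zmod_val]
  rfl

/-- An alternating biadditive map on a plane is a multiple of the determinant. -/
lemma exists_det_eq (hζ : ∀ m : M, p • m = 0 → ∃ s, ζ s = m) (hinj : Function.Injective ζ)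
    (B : F →+ F →+ M) (hB : ∀ x, B x x = 0) :
    ∃ t, ∀ x y, B x y =
      ζ (t * (e.coord 0 x * e.coord 1 y) - t * (e.coord 0 y * e.coord 1 x)) := by
  obtain ⟨s₀, t₀, s₁, t₁, h⟩ := exists_form₂_eq e hζ B
  have hz (x : F) : e.coord 0 x * form e s₀ t₀ x + e.coord 1 x * form e s₁ t₁ x = 0 :=
    (injective_iff_map_eq_zero ζ).mp hinj _ ((h x x).symm.trans (hB x))
  have h₀ : s₀ = 0 := by simpa [form_apply] using hz (e 0)
  have h₁ : t₁ = 0 := by simpa [form_apply] using hz (e 1)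
  have h₂ : t₀ + s₁ = 0 := by simpa [form_apply, h₀, h₁] using hz (e 0 + e 1)
  refine ⟨t₀, fun x y => ?_⟩
  rw [h, form_apply, form_apply, h₀, h₁]
  congr 1
  linear_combination e.coord 1 x * e.coord 0 y * h₂

/-- The standard family of cocycles on the Heisenberg group. -/
noncomputable def stdCocycle (t : Fin 8 → ZMod p) (x y : Heisenberg F) : ZMod p :=
  t 0 * (e.coord 0 x.a * e.coord 1 y.a) + t 1 * (e.coord 0 x.b * e.coord 1 y.b)
    + form e (t 2) (t 3) (x.c * y.a + x.b * y.a ^ 2 / 2)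
    + form e (t 4) (t 5) (x.b * y.c + x.b ^ 2 * y.a / 2)
    + e.coord 1 x.b * form e (t 6) (t 7) y.a

lemma stdCocycle_add (t u : Fin 8 → ZMod p) (x y : Heisenberg F) :
    stdCocycle e (t + u) x y = stdCocycle e t x y + stdCocycle e u x y := by
  simp only [stdCocycle, form_apply, Pi.add_apply]; ring

lemma isAdd2Cocycle_stdCocycle (h2 : (2 : F) ≠ 0) (ζ : ZMod p →+ M) (t : Fin 8 → ZMod p) :
    IsAdd2Cocycle (fun x y => ζ (stdCocycle e t x y)) where
  map_one_one := by simp [stdCocycle]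
  add_eq x y z := by
    rw [← map_add, ← map_add]
    congr 1
    have key (L : F →ₗ[ZMod p] ZMod p) {u v w r : F} (h : u + v = w + r) :
        L u + L v = L w + L r := by rw [← map_add, h, map_add]
    have h₁ := key (form e (t 2) (t 3)) <| show
      (x.c * y.a + x.b * y.a ^ 2 / 2) + ((x * y).c * z.a + (x * y).b * z.a ^ 2 / 2) =
      (x.c * (y * z).a + x.b * (y * z).a ^ 2 / 2) + (y.c * z.a + y.b * z.a ^ 2 / 2) by
        simp only [mul_a, mul_b, mul_c]; field_simp; ring
    have h₂ := key (form e (t 4) (t 5)) <| show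
      (x.b * y.c + x.b ^ 2 * y.a / 2) + ((x * y).b * z.c + (x * y).b ^ 2 * z.a / 2) =
      (x.b * (y * z).c + x.b ^ 2 * (y * z).a / 2) + (y.b * z.c + y.b ^ 2 * z.a / 2) by
        simp only [mul_a, mul_b, mul_c]; field_simp; ring
    have h₃ := map_add (form e (t 6) (t 7)) y.a z.a
    simp only [stdCocycle, mul_a, mul_b, map_add (e.coord _)] at *
    linear_combination h₁ + h₂ - e.coord 1 x.b * h₃

lemma commPairing_stdCocycle_elemA (t : Fin 8 → ZMod p) (a a' : F) :
    commPairing (fun x y => ζ (stdCocycle e t x y)) (elemA a) (elemA a') =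
      ζ (t 0 * (e.coord 0 a * e.coord 1 a') - t 0 * (e.coord 0 a' * e.coord 1 a)) := by
  simp [commPairing, stdCocycle, elemA]

lemma commPairing_stdCocycle_elemB (t : Fin 8 → ZMod p) (b b' : F) :
    commPairing (fun x y => ζ (stdCocycle e t x y)) (elemB b) (elemB b') =
      ζ (t 1 * (e.coord 0 b * e.coord 1 b') - t 1 * (e.coord 0 b' * e.coord 1 b)) := by
  simp [commPairing, stdCocycle, elemB]

lemma commPairing_stdCocycle_elemA_elemZ (t : Fin 8 → ZMod p) (a z : F) :
    commPairing (fun x y => ζ (stdCocycle e t x y)) (elemA a) (elemZ z) =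
      -ζ (form e (t 2) (t 3) (z * a)) := by
  simp [commPairing, stdCocycle, elemA, elemZ]

lemma commPairing_stdCocycle_elemB_elemZ (t : Fin 8 → ZMod p) (b z : F) :
    commPairing (fun x y => ζ (stdCocycle e t x y)) (elemB b) (elemZ z) =
      ζ (form e (t 4) (t 5) (b * z)) := by
  simp [commPairing, stdCocycle, elemB, elemZ]

lemma mixedDefect_stdCocycle (he : e 0 = 1) (t : Fin 8 → ZMod p) (h₂ : t 2 = 0) (h₃ : t 3 = 0)
    (h₄ : t 4 = 0) (h₅ : t 5 = 0) (b a : F) :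
    mixedDefect (fun x y => ζ (stdCocycle e t x y)) b a =
      ζ (e.coord 1 b * form e (t 6) (t 7) a) := by
  have h1 : e.repr 1 1 = 0 := by rw [← he]; simp
  simp [mixedDefect, liftCommutator, commutatorElement_eq, stdCocycle, elemA, elemB, elemZ,
    form_apply, h₂, h₃, h₄, h₅, h1]

lemma stdCocycle_eq_zero (he : e 0 = 1) (hinj : Function.Injective ζ) (t : Fin 8 → ZMod p)
    {f : Heisenberg F → M} (hf : ∀ x y, ζ (stdCocycle e t x y) = f x + f y - f (x * y)) :
    t = 0 := by
  have hz := (injective_iff_map_eq_zero ζ).mp hinj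
  have hpair {x y : Heisenberg F} (h : Commute x y) :
      commPairing (fun x y => ζ (stdCocycle e t x y)) x y = 0 := by
    simp only [commPairing, hf, h.eq]; abel
  have hmix (b a : F) : mixedDefect (fun x y => ζ (stdCocycle e t x y)) b a = 0 := by
    have hl (x y : Heisenberg F) :
        liftCommutator (fun x y => ζ (stdCocycle e t x y)) x y = -f ⁅x, y⁆ := by
      have : ⁅x, y⁆ * (y * x) = x * y := by simp [commutatorElement_def]
      simp only [liftCommutator, hf, this]
      abel
    simp only [mixedDefect, hl, commutatorElement_elemB_elemA, one_mul, sub_self]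
  have h0 := hz _ ((commPairing_stdCocycle_elemA e t _ _).symm.trans
    (hpair (commute_elemA (e 0) (e 1))))
  have h1 := hz _ ((commPairing_stdCocycle_elemB e t _ _).symm.trans
    (hpair (commute_elemB (e 0) (e 1))))
  have hA (z : F) := hz _ (neg_eq_zero.mp ((commPairing_stdCocycle_elemA_elemZ e t 1 z).symm.trans
    (hpair (commute_elemZ z _).symm)))
  have hB (z : F) := hz _ ((commPairing_stdCocycle_elemB_elemZ e t 1 z).symm.trans
    (hpair (commute_elemZ z _).symm))
  have h2 := hA (e 0)
  have h3 := hA (e 1)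
  have h4 := hB (e 0)
  have h5 := hB (e 1)
  simp [form_apply] at h0 h1 h2 h3 h4 h5
  have hM (a : F) := hz _ ((mixedDefect_stdCocycle e he t h2 h3 h4 h5 (e 1) a).symm.trans
    (hmix _ _))
  have h6 := hM (e 0)
  have h7 := hM (e 1)
  simp [form_apply] at h6 h7
  ext i
  fin_cases i <;> assumption

/-- The commutator pairing along a commuting additive family, as a biadditive map. -/
def pairingHom {α : Heisenberg F → Heisenberg F → M} (hα : IsAdd2Cocycle α) {X : F → Heisenberg F}
    (hX : ∀ a a', Commute (X a) (X a')) (hadd : ∀ a a', X (a + a') = X a * X a') : F →+ F →+ M :=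
  AddMonoidHom.mk' (fun a => AddMonoidHom.mk' (fun a' => commPairing α (X a) (X a')) fun a' a'' => by
    rw [hadd, hα.commPairing_mul_right (hX _ _) (hX _ _)]) fun a a' => by
    ext a''
    simp [hadd, hα.commPairing_mul_left (hX a'' _) (hX a'' _)]

/-- The commutator pairing of `x` with the centre, as an additive map. -/
def centerPairingHom {α : Heisenberg F → Heisenberg F → M} (hα : IsAdd2Cocycle α)
    (x : Heisenberg F) : F →+ M :=
  AddMonoidHom.mk' (fun z => commPairing α x (elemZ z)) fun z z' => by
    rw [elemZ_add, hα.commPairing_mul_right (commute_elemZ _ _).symm (commute_elemZ _ _).symm]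

lemma exists_commTrivial_sub (hζ : ∀ m : M, p • m = 0 → ∃ s, ζ s = m)
    (hinj : Function.Injective ζ) {α : Heisenberg F → Heisenberg F → M} (hα : IsAdd2Cocycle α) :
    ∃ t, CommTrivial (α - fun x y => ζ (stdCocycle e t x y)) := by
  obtain ⟨t₀, h₀⟩ := exists_det_eq e hζ hinj (pairingHom hα commute_elemA elemA_add)
    fun x => commPairing_self _ _
  obtain ⟨t₁, h₁⟩ := exists_det_eq e hζ hinj (pairingHom hα commute_elemB elemB_add)
    fun x => commPairing_self _ _
  obtain ⟨t₂, t₃, h₃⟩ := exists_form_eq e hζ (-centerPairingHom hα (elemA 1))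
  obtain ⟨t₄, t₅, h₅⟩ := exists_form_eq e hζ (centerPairingHom hα (elemB 1))
  refine ⟨![t₀, t₁, t₂, t₃, t₄, t₅, 0, 0], ?_, ?_, ?_, ?_⟩ <;> intro x y <;>
    rw [commPairing_sub, sub_eq_zero]
  · rw [commPairing_stdCocycle_elemA]
    exact h₀ x y
  · rw [commPairing_stdCocycle_elemB]
    exact h₁ x y
  · rw [commPairing_stdCocycle_elemA_elemZ,
      (commPairing_of_shear hα commute_elemA exists_conj_elemA).2]
    exact neg_eq_iff_eq_neg.mp (h₃ (y * x))
  · rw [commPairing_stdCocycle_elemB_elemZ, mul_comm x,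
      (commPairing_of_shear hα commute_elemB exists_conj_elemB).2]
    exact h₅ (y * x)

/-- Every cocycle is cohomologous to a standard one. -/
theorem exists_eq_stdCocycle_add [DivisibleBy M ℤ] (he : e 0 = 1) (h2 : (2 : F) ≠ 0)
    (hζ : ∀ m : M, p • m = 0 → ∃ s, ζ s = m) (hinj : Function.Injective ζ)
    {α : Heisenberg F → Heisenberg F → M} (hα : IsAdd2Cocycle α) :
    ∃ (t : Fin 8 → ZMod p) (f : Heisenberg F → M), f 1 = 0 ∧
      ∀ x y, α x y = f x + f y - f (x * y) + ζ (stdCocycle e t x y) := by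
  obtain ⟨t, ht⟩ := exists_commTrivial_sub e hζ hinj hα
  have hβ := hα.sub (isAdd2Cocycle_stdCocycle e h2 ζ t)
  set β := α - fun x y => ζ (stdCocycle e t x y) with hβdef
  let B : F →+ F →+ M := AddMonoidHom.mk'
    (fun b => AddMonoidHom.mk' (mixedDefect β b) (ht.mixedDefect_add_right hβ b)) fun b b' => by
      ext a
      exact ht.mixedDefect_add_left hβ b b' a
  obtain ⟨s₀, t₀, s₁, t₁, hB⟩ := exists_form₂_eq e hζ B
  have hB' (b a : F) : mixedDefect β b a = ζ (e.coord 1 b * form e s₁ t₁ a) := by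
    have h0 : ζ (form e s₀ t₀ a) = 0 := by
      have h := hB (e 0) a
      simp only [he, B, AddMonoidHom.mk'_apply, mixedDefect_one] at h
      rw [← he] at h
      simpa using h.symm
    refine (hB b a).trans ?_
    rw [(injective_iff_map_eq_zero ζ).mp hinj _ h0, mul_zero, zero_add]
  let u : Fin 8 → ZMod p := ![0, 0, 0, 0, 0, 0, s₁, t₁]
  have hγ := hβ.sub (isAdd2Cocycle_stdCocycle e h2 ζ u)
  have hct : CommTrivial (β - fun x y => ζ (stdCocycle e u x y)) := by
    constructor <;> intro x y <;> rw [commPairing_sub]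
    · rw [ht.elemA_elemA, commPairing_stdCocycle_elemA]; simp [u]
    · rw [ht.elemB_elemB, commPairing_stdCocycle_elemB]; simp [u]
    · rw [ht.elemA_elemZ, commPairing_stdCocycle_elemA_elemZ]; simp [u, form_apply]
    · rw [ht.elemB_elemZ, commPairing_stdCocycle_elemB_elemZ]; simp [u, form_apply]
  obtain ⟨f, hf1, hf⟩ := hct.exists_eq hγ fun b a => by
    rw [mixedDefect_sub, hB', mixedDefect_stdCocycle e he u rfl rfl rfl rfl]
    exact sub_self _
  refine ⟨t + u, f, hf1, fun x y => ?_⟩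
  rw [← hf, stdCocycle_add, map_add]
  simp only [hβdef, Pi.sub_apply]
  abel

end PrimeTorsion

end Heisenberg

lemma exists_zmod_hom_complexUnits (p : ℕ) [NeZero p] :
    ∃ ζ : ZMod p →+ Additive ℂˣ, Function.Injective ζ ∧
      ∀ m : Additive ℂˣ, p • m = 0 → ∃ s, ζ s = m := by
  have h := (Complex.isPrimitiveRoot_exp p (NeZero.ne p)).isUnit_unit (NeZero.ne p)
  refine ⟨(Subgroup.zpowers _).subtype.toAdditive.comp h.zmodEquivZPowers.toAddMonoidHom,
    Subtype.val_injective.comp h.zmodEquivZPowers.injective, fun m hm => ?_⟩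
  have hmem : m.toMul ∈ rootsOfUnity p ℂ := hm
  rw [← h.zpowers_eq] at hmem
  exact ⟨h.zmodEquivZPowers.symm (Additive.ofMul ⟨m.toMul, hmem⟩),
    congrArg Subtype.val (h.zmodEquivZPowers.apply_symm_apply _)⟩

noncomputable instance : DivisibleBy (Additive ℂˣ) ℤ :=
  letI : DivisibleBy (Additive ℂˣ) ℕ := divisibleByOfSMulRightSurj _ _ fun {n} hn m => by
    obtain ⟨z, hz⟩ := IsAlgClosed.exists_pow_nat_eq (m.toMul : ℂ) (Nat.pos_of_ne_zero hn)
    have hz0 : z ≠ 0 := by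
      rintro rfl
      exact m.toMul.ne_zero (hz.symm.trans (zero_pow hn))
    exact ⟨Additive.ofMul (Units.mk0 z hz0), Units.ext hz⟩
  AddGroup.divisibleByIntOfDivisibleByNat _

lemma isAdd2Cocycle_ofMul {G : Type*} [Group G] {α : G × G → ℂˣ} (hα : IsMul2Cocycle α) :
    IsAdd2Cocycle (fun x y => Additive.ofMul (α (x, y))) :=
  ⟨hα.1, hα.2⟩

lemma IsAdd2Cocycle.isMul2Cocycle {G : Type*} [Group G] {α : G → G → Additive ℂˣ}
    (hα : IsAdd2Cocycle α) : IsMul2Cocycle (fun z : G × G => (α z.1 z.2).toMul) :=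
  ⟨hα.1, hα.2⟩

/-- The Schur multiplier of the Heisenberg group over the field `𝔽_{p²}` with `p²`
elements, for `p` an odd prime, is isomorphic as an abelian group to `(ℤ/pℤ)⁸`. -/
theorem schurMultiplier_heisenberg_galoisField (p : ℕ) [Fact p.Prime] (hodd : Odd p) :
    Nonempty
      (SchurMultiplier (Heisenberg (GaloisField p 2)) ≃* Multiplicative (Fin 8 → ZMod p)) := by
  have h2 : (2 : GaloisField p 2) ≠ 0 := Ring.two_ne_zero <| by
    rw [ringChar.eq (GaloisField p 2) p]
    rintro rfl
    exact absurd hodd (by decide)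
  obtain ⟨e, he⟩ : ∃ e : Module.Basis (Fin 2) (ZMod p) (GaloisField p 2), e 0 = 1 := by
    have hfin := GaloisField.finrank p two_ne_zero
    obtain ⟨θ, hθ⟩ := exists_linearIndependent_pair_of_one_lt_finrank (R := ZMod p)
      (M := GaloisField p 2) (by rw [hfin]; norm_num) one_ne_zero
    exact ⟨basisOfLinearIndependentOfCardEqFinrank hθ (by simp [hfin]), by simp⟩
  obtain ⟨ζ, hinj, hζ⟩ := exists_zmod_hom_complexUnits p
  let c (t : Fin 8 → ZMod p) : mul2Cocycles (Heisenberg (GaloisField p 2)) :=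
    ⟨fun z => (ζ (Heisenberg.stdCocycle e t z.1 z.2)).toMul,
      (Heisenberg.isAdd2Cocycle_stdCocycle e h2 ζ t).isMul2Cocycle⟩
  let Ψ : Multiplicative (Fin 8 → ZMod p) →* SchurMultiplier (Heisenberg (GaloisField p 2)) :=
    (QuotientGroup.mk' _).comp <| MonoidHom.mk' (fun t => c t.toAdd) fun t u => by
      ext1
      funext z
      exact (congrArg ζ (Heisenberg.stdCocycle_add e t.toAdd u.toAdd z.1 z.2)).trans (map_add ζ _ _)
  refine ⟨(MulEquiv.ofBijective Ψ ⟨?_, fun q => ?_⟩).symm⟩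
  · rw [injective_iff_map_eq_one]
    intro t ht
    obtain ⟨f, -, hf⟩ := (QuotientGroup.eq_one_iff _).mp ht
    refine Heisenberg.stdCocycle_eq_zero e he hinj t.toAdd
      (f := fun x => Additive.ofMul (f x)) fun x y => ?_
    rw [sub_eq_add_neg]
    exact hf x y
  · obtain ⟨⟨α, hα⟩, rfl⟩ := QuotientGroup.mk_surjective q
    obtain ⟨t, f, hf1, hf⟩ :=
      Heisenberg.exists_eq_stdCocycle_add e he h2 hζ hinj (isAdd2Cocycle_ofMul hα)
    refine ⟨Multiplicative.ofAdd t, QuotientGroup.eq.mpr ⟨fun x => (f x).toMul, hf1, fun x y => ?_⟩⟩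
    have h := hf x y
    rw [sub_eq_add_neg] at h
    exact inv_mul_eq_iff_eq_mul.mpr (h.trans (add_comm _ _))
end

section
/- Let K be a finite group with an abelian normal subgroup N such that K/N is abelian, and let χ : N → ℂˣ be a group homomorphism that is K-invariant, i.e. χ(k n k⁻¹) = χ(n) for all k ∈ K and n ∈ N. Then χ extends to a group homomorphism K → ℂˣ if and only if the commutator subgroup [K,K] is contained in the kernel of χ. -/
/-- A complex linear character of a subgroup `N` of a finite group `K` that is trivial on every
element of `N` lying in the commutator subgroup of `K` extends to `K`. -/
theorem MonoidHom.exists_extension_of_eq_one_of_mem_commutator {K : Type*} [Group K] [Finite K]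
    (N : Subgroup K) (χ : N →* ℂˣ) (h : ∀ n : N, (n : K) ∈ commutator K → χ n = 1) :
    ∃ χ' : K →* ℂˣ, ∀ n : N, χ' (n : K) = χ n := by
  let f : N →* Abelianization K := Abelianization.of.comp N.subtype
  have hf : Function.Surjective f.rangeRestrict := f.rangeRestrict_surjective
  have hker : f.rangeRestrict.ker ≤ χ.ker := by
    intro n hn
    rw [MonoidHom.ker_rangeRestrict] at hn
    exact h n ((QuotientGroup.eq_one_iff (N := commutator K) (n : K)).mp hn)
  have : Finite (Abelianization K) := Quotient.finite _
  have : NeZero (Monoid.exponent (Abelianization K)) := ⟨Monoid.exponent_ne_zero_of_finite⟩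
  obtain ⟨ψ, hψ⟩ := MonoidHom.domRestrict_surjective ℂ f.range
    (f.rangeRestrict.liftOfSurjective hf ⟨χ, hker⟩)
  refine ⟨ψ.comp Abelianization.of, fun n => ?_⟩
  have h₁ := DFunLike.congr_fun hψ (f.rangeRestrict n)
  have h₂ := f.rangeRestrict.liftOfRightInverse_comp_apply _
    (Function.rightInverse_surjInv hf) ⟨χ, hker⟩ n
  exact h₁.trans h₂

/-- Let `K` be a finite group with an abelian normal subgroup `N` such that `K/N` is
abelian, and let `χ : N → ℂˣ` be a `K`-invariant homomorphism (`χ(knk⁻¹) = χ(n)` for all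
`k ∈ K`, `n ∈ N`).  Then `χ` extends to a homomorphism `K → ℂˣ` if and only if the
commutator subgroup `[K,K]` is contained in the kernel of `χ`. -/
theorem extends_iff_commutator_le_ker {K : Type*} [Group K] [Finite K]
    (N : Subgroup K) [hN : N.Normal]
    (habN : ∀ a b : N, a * b = b * a)
    (habQ : ∀ a b : K ⧸ N, a * b = b * a)
    (χ : N →* ℂˣ)
    (hinv : ∀ (k : K) (n : N), χ ⟨k * (n : K) * k⁻¹, hN.conj_mem (n : K) n.2 k⟩ = χ n) :
    (∃ χ' : K →* ℂˣ, ∀ n : N, χ' (n : K) = χ n) ↔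
      commutator K ≤ Subgroup.map N.subtype χ.ker := by
  constructor
  · rintro ⟨χ', hχ'⟩
    refine Subgroup.commutator_le.mpr fun a _ b _ => ?_
    have hmem : a * b * a⁻¹ * b⁻¹ ∈ N := by
      rw [← QuotientGroup.eq_one_iff]
      exact commutatorElement_eq_one_iff_mul_comm.mpr (habQ a b)
    refine ⟨⟨a * b * a⁻¹ * b⁻¹, hmem⟩, ?_, rfl⟩
    change χ ⟨a * b * a⁻¹ * b⁻¹, hmem⟩ = 1
    simp [← hχ']
  · intro h
    refine MonoidHom.exists_extension_of_eq_one_of_mem_commutator N χ fun n hn => ?_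
    obtain ⟨m, hm, hmn⟩ := h hn
    rwa [Subtype.ext hmn] at hm
end

section
/- Let p be an odd prime and let G* be the group presented by generators x₁, x₂, y₁, y₂, z₁, z₂, w₁, w₂, w₃, w₄, v₁, v₂, u₁, u₂ and relations: [y₁,x₁]=z₁, [y₁,x₂]=z₂, [x₂,x₁]=w₁, [y₂,x₁]=z₂w₂, [y₂,x₂]=w₃, [y₂,y₁]=w₄, [z₁,x₁]=v₁, [z₁,x₂]=v₂, [z₁,y₁]=u₁, [z₁,y₂]=u₂, [z₂,x₁]=v₂, [z₂,y₁]=u₂, x₁ᵖ=x₂ᵖ=y₁ᵖ=y₂ᵖ=z₁ᵖ=z₂ᵖ=w₁ᵖ=w₂ᵖ=w₃ᵖ=w₄ᵖ=1, together with the relations declaring trivial every commutator of two generators not determined by the above (in particular w₁,w₂,w₃,w₄,u₁,u₂,v₁,v₂ are central and [z₁,z₂]=[z₂,x₂]=[z₂,y₂]=1). Then G* has order p¹⁴; the subgroup A generated by w₁,w₂,w₃,w₄,u₁,u₂,v₁,v₂ is contained in Z(G*) ∩ [G*,G*], is isomorphic to (ℤ/pℤ)⁸, and G*/A ≅ H₃(𝔽_p[t]/(t²)).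 Hence G* is a representation group of H₃(𝔽_p[t]/(t²)). -/
open Polynomial

namespace Stmt8

/-- Generators of the presented group `G*`. -/
inductive Gen
  | x1 | x2 | y1 | y2 | z1 | z2 | w1 | w2 | w3 | w4 | v1 | v2 | u1 | u2
  deriving DecidableEq

open Gen FreeGroup

/-- The commutator `[a,b] = a⁻¹b⁻¹ab`. -/
def comm (a b : FreeGroup Gen) : FreeGroup Gen := a⁻¹ * b⁻¹ * a * b

/-- The ordered pairs of generators whose commutator is specified by one of the listed
(possibly nontrivial) relations. -/
def specified : List (Gen × Gen) :=
  [(y1, x1), (y1, x2), (x2, x1), (y2, x1), (y2, x2), (y2, y1),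
   (z1, x1), (z1, x2), (z1, y1), (z1, y2), (z2, x1), (z2, y1)]

/-- The relators of `G*`: the listed commutator relations, the `p`-th power relations,
and trivial commutator relations for every pair of generators whose commutator is not
determined by the listed relations (in particular `w₁, w₂, w₃, w₄, u₁, u₂, v₁, v₂`
are central and `[z₁,z₂] = [z₂,x₂] = [z₂,y₂] = 1`). -/
def rels (p : ℕ) : Set (FreeGroup Gen) :=
  ({comm (of y1) (of x1) * (of z1)⁻¹,
    comm (of y1) (of x2) * (of z2)⁻¹,
    comm (of x2) (of x1) * (of w1)⁻¹,
    comm (of y2) (of x1) * (of z2 * of w2)⁻¹,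
    comm (of y2) (of x2) * (of w3)⁻¹,
    comm (of y2) (of y1) * (of w4)⁻¹,
    comm (of z1) (of x1) * (of v1)⁻¹,
    comm (of z1) (of x2) * (of v2)⁻¹,
    comm (of z1) (of y1) * (of u1)⁻¹,
    comm (of z1) (of y2) * (of u2)⁻¹,
    comm (of z2) (of x1) * (of v2)⁻¹,
    comm (of z2) (of y1) * (of u2)⁻¹} : Set (FreeGroup Gen)) ∪
  {r | ∃ g h : Gen, r = comm (of g) (of h) ∧ (g, h) ∉ specified ∧ (h, g) ∉ specified} ∪
  ({of x1 ^ p, of x2 ^ p, of y1 ^ p, of y2 ^ p, of z1 ^ p, of z2 ^ p,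
    of w1 ^ p, of w2 ^ p, of w3 ^ p, of w4 ^ p} : Set (FreeGroup Gen))

/-- The group `G*` presented by the generators and relations above. -/
abbrev Gstar (p : ℕ) := PresentedGroup (rels p)

/-- The subgroup `A` of `G*` generated by the images of
`w₁, w₂, w₃, w₄, u₁, u₂, v₁, v₂`. -/
def A (p : ℕ) : Subgroup (Gstar p) :=
  Subgroup.closure
    {PresentedGroup.of w1, PresentedGroup.of w2, PresentedGroup.of w3,
     PresentedGroup.of w4, PresentedGroup.of u1, PresentedGroup.of u2,
     PresentedGroup.of v1, PresentedGroup.of v2}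

section Cardinality

open scoped Pointwise

variable {G : Type*} [Group G]

/-- Adjoining to a finite subgroup an element of exponent `p` whose commutators with the
generators lie in the subgroup multiplies the order by at most `p`. -/
lemma card_closure_insert_le {p m : ℕ} (hp : 0 < p) {s : Set G} {x : G}
    (hfin : Finite (Subgroup.closure s)) (hcard : Nat.card (Subgroup.closure s) ≤ m)
    (hx : x ^ p = 1) (hcomm : ∀ y ∈ s, y⁻¹ * x⁻¹ * y * x ∈ Subgroup.closure s) :
    Finite (Subgroup.closure (insert x s)) ∧
      Nat.card (Subgroup.closure (insert x s)) ≤ p * m := by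
  have hconj : Subgroup.closure s ≤
      (Subgroup.closure s).comap (MulAut.conj x⁻¹).toMonoidHom := by
    rw [Subgroup.closure_le]
    intro y hy
    have := mul_mem (Subgroup.subset_closure hy) (hcomm y hy)
    simpa [mul_assoc] using this
  have hnorm : x⁻¹ ∈ Subgroup.normalizer (Subgroup.closure s : Set G) := by
    have : Finite ((Subgroup.closure s : Subgroup G) : Set G) := hfin
    apply Subgroup.mem_normalizer_fintype
    intro n hn
    simpa using hconj hn
  have hle : Subgroup.zpowers x ≤ Subgroup.normalizer (Subgroup.closure s : Set G) := by
    rw [Subgroup.zpowers_le]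
    simpa using inv_mem hnorm
  have hxfin : IsOfFinOrder x := isOfFinOrder_iff_pow_eq_one.2 ⟨p, hp, hx⟩
  have hcoe : ((Subgroup.closure (insert x s) : Subgroup G) : Set G) =
      (Subgroup.zpowers x : Set G) * (Subgroup.closure s : Set G) := by
    rw [Set.insert_eq, Subgroup.closure_union, ← Subgroup.zpowers_eq_closure,
      Subgroup.coe_mul_of_left_le_normalizer_right _ _ hle]
  have hfinx : ((Subgroup.zpowers x : Subgroup G) : Set G).Finite :=
    hxfin.finite_zpowers
  constructor
  · have := hfinx.mul (Set.toFinite ((Subgroup.closure s : Subgroup G) : Set G))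
    rw [← hcoe] at this
    exact this
  · calc Nat.card (Subgroup.closure (insert x s))
        = Nat.card ((Subgroup.zpowers x : Set G) * (Subgroup.closure s : Set G) : Set G) := by
          rw [← hcoe]; rfl
      _ ≤ Nat.card (Subgroup.zpowers x) * Nat.card (Subgroup.closure s) := Set.natCard_mul_le
      _ ≤ p * m := by
          gcongr
          rw [Nat.card_zpowers]
          exact orderOf_le_of_pow_eq_one hp hx

/-- A group with a polycyclic generating sequence of `p`-torsion elements, each commutator
of which is a word in the later generators, is finite, with the expected bound on its order. -/
lemma card_closure_list_le {ι : Type*} {p : ℕ} (hp : 0 < p) (f : ι → G)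
    (hpow : ∀ i, f i ^ p = 1) (c : ι → ι → List ι) :
    ∀ l : List ι,
      (∀ t ∈ l.tails, ∀ x ∈ t.head?, ∀ y ∈ t.tail,
        (f y)⁻¹ * (f x)⁻¹ * f y * f x = ((c y x).map f).prod ∧ c y x ⊆ t.tail) →
      Finite (Subgroup.closure (f '' {i | i ∈ l})) ∧
        Nat.card (Subgroup.closure (f '' {i | i ∈ l})) ≤ p ^ l.length := by
  intro l
  induction l with
  | nil =>
    intro _
    simp only [List.not_mem_nil, Set.ofPred_false, Set.image_empty, Subgroup.closure_empty]
    exact ⟨inferInstance, by simp⟩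
  | cons x t ih =>
    intro h
    obtain ⟨hfin, hcard⟩ := ih fun t' ht' => h t' (List.mem_cons_of_mem _ ht')
    have hset : f '' {i | i ∈ x :: t} = insert (f x) (f '' {i | i ∈ t}) := by
      rw [← Set.image_insert_eq]
      congr 1
      ext i
      simp
    rw [hset, List.length_cons, pow_succ']
    refine card_closure_insert_le hp hfin hcard (hpow x) ?_
    rintro _ ⟨y, hy, rfl⟩
    obtain ⟨hprod, hsub⟩ := h (x :: t) (by simp) x (by simp) y hy
    rw [hprod]
    apply list_prod_mem
    simp only [List.mem_map]
    rintro _ ⟨i, hi, rfl⟩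
    exact Subgroup.subset_closure ⟨i, hsub hi, rfl⟩

end Cardinality

section Relations

variable {p : ℕ}

/-- The right-hand side of the relation for the commutator `[y, x]`. -/
def commWord : Gen → Gen → List Gen
  | y1, x1 => [z1]
  | y1, x2 => [z2]
  | x2, x1 => [w1]
  | y2, x1 => [z2, w2]
  | y2, x2 => [w3]
  | y2, y1 => [w4]
  | z1, x1 => [v1]
  | z1, x2 => [v2]
  | z1, y1 => [u1]
  | z1, y2 => [u2]
  | z2, x1 => [v2]
  | z2, y1 => [u2]
  | _, _ => []

lemma comm_eq_commWord {y x : Gen} (h : (x, y) ∉ specified) :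
    (PresentedGroup.of y : Gstar p)⁻¹ * (PresentedGroup.of x)⁻¹ * PresentedGroup.of y *
      PresentedGroup.of x = ((commWord y x).map PresentedGroup.of).prod := by
  by_cases h' : (y, x) ∈ specified
  · have key : comm (of y) (of x) * ((commWord y x).map of).prod⁻¹ ∈ rels p := by
      refine Or.inl (Or.inl ?_)
      simp only [specified, List.mem_cons, Prod.mk.injEq, List.not_mem_nil, or_false] at h'
      rcases h' with ⟨rfl, rfl⟩ | ⟨rfl, rfl⟩ | ⟨rfl, rfl⟩ | ⟨rfl, rfl⟩ | ⟨rfl, rfl⟩ | ⟨rfl, rfl⟩ |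
        ⟨rfl, rfl⟩ | ⟨rfl, rfl⟩ | ⟨rfl, rfl⟩ | ⟨rfl, rfl⟩ | ⟨rfl, rfl⟩ | ⟨rfl, rfl⟩ <;>
      simp [commWord]
    have := PresentedGroup.mk_eq_mk_of_mul_inv_mem key
    simp only [comm, _root_.map_mul, _root_.map_inv, map_list_prod, List.map_map] at this
    exact this
  · have key : comm (of y) (of x) ∈ rels p := Or.inl (Or.inr ⟨y, x, rfl, h', h⟩)
    have hnil : commWord y x = [] := by
      revert h'
      cases y <;> cases x <;> first | (intro; rfl) | (intro h'; exact absurd (by decide) h')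
    have := PresentedGroup.one_of_mem key
    simpa [comm, hnil, PresentedGroup.of] using this

lemma commute_of {x y : Gen} (h : (x, y) ∉ specified) (h' : (y, x) ∉ specified) :
    Commute (PresentedGroup.of x : Gstar p) (PresentedGroup.of y) := by
  have := PresentedGroup.one_of_mem (rels := rels p) (Or.inl (Or.inr ⟨x, y, rfl, h, h'⟩))
  simp only [comm, _root_.map_mul, _root_.map_inv] at this
  rw [mul_assoc, ← mul_inv_rev, inv_mul_eq_one] at this
  exact this.symm

lemma pow_eq_one_of_mul_eq {G : Type*} [Group G] {z x v : G} {n : ℕ}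
    (h : z⁻¹ * x⁻¹ * z * x = v) (hzv : Commute z v) (hz : z ^ n = 1) : v ^ n = 1 := by
  have h1 : x⁻¹ * z * x = z * v := by rw [← h]; group
  have h2 : (x⁻¹ * z * x) ^ n = 1 := by
    have := conj_pow (i := n) (a := x⁻¹) (b := z)
    rw [inv_inv] at this
    rw [this, hz]
    simp
  rw [h1, hzv.mul_pow, hz, one_mul] at h2
  exact h2

lemma of_pow_eq_one (g : Gen) : (PresentedGroup.of g : Gstar p) ^ p = 1 := by
  have base (g : Gen) (hg : g ≠ v1 ∧ g ≠ v2 ∧ g ≠ u1 ∧ g ≠ u2) :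
      (PresentedGroup.of g : Gstar p) ^ p = 1 := by
    have : of g ^ p ∈ rels p := by
      refine Or.inr ?_
      cases g <;> simp at hg ⊢
    simpa [PresentedGroup.of] using PresentedGroup.one_of_mem this
  have derived (z x v : Gen) (hz : z ≠ v1 ∧ z ≠ v2 ∧ z ≠ u1 ∧ z ≠ u2)
      (hxz : (x, z) ∉ specified) (hc : commWord z x = [v])
      (h : (z, v) ∉ specified) (h' : (v, z) ∉ specified) :
      (PresentedGroup.of v : Gstar p) ^ p = 1 :=
    pow_eq_one_of_mul_eq (by simpa [hc] using comm_eq_commWord (p := p) hxz) (commute_of h h')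
      (base z hz)
  cases g
  case v1 => exact derived z1 x1 v1 (by decide) (by decide) rfl (by decide) (by decide)
  case v2 => exact derived z1 x2 v2 (by decide) (by decide) rfl (by decide) (by decide)
  case u1 => exact derived z1 y1 u1 (by decide) (by decide) rfl (by decide) (by decide)
  case u2 => exact derived z1 y2 u2 (by decide) (by decide) rfl (by decide) (by decide)
  all_goals exact base _ (by decide)

lemma finite_and_card_le (hp : 0 < p) : Finite (Gstar p) ∧ Nat.card (Gstar p) ≤ p ^ 14 := by
  have h := card_closure_list_le hp (PresentedGroup.of : Gen → Gstar p) of_pow_eq_one commWord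
    [x1, x2, y1, y2, z1, z2, w1, w2, w3, w4, v1, v2, u1, u2] fun t ht x hx y hy =>
      have aux : ∀ t ∈ [x1, x2, y1, y2, z1, z2, w1, w2, w3, w4, v1, v2, u1, u2].tails,
        ∀ x ∈ t.head?, ∀ y ∈ t.tail, (x, y) ∉ specified ∧ commWord y x ⊆ t.tail := by decide
      ⟨comm_eq_commWord (aux t ht x hx y hy).1, (aux t ht x hx y hy).2⟩
  have huniv : {i | i ∈ [x1, x2, y1, y2, z1, z2, w1, w2, w3, w4, v1, v2, u1, u2]} =
      (Set.univ : Set Gen) := by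
    ext g
    cases g <;> simp
  rw [huniv, Set.image_univ, PresentedGroup.closure_range_of] at h
  exact ⟨Subgroup.topEquiv.toEquiv.finite_iff.1 h.1,
    (Nat.card_congr Subgroup.topEquiv.toEquiv).symm.trans_le h.2⟩

lemma A_le_center : A p ≤ Subgroup.center (Gstar p) := by
  have hcentral (a : Gen) (ha : ∀ g, (a, g) ∉ specified ∧ (g, a) ∉ specified) :
      (PresentedGroup.of a : Gstar p) ∈ Subgroup.center (Gstar p) := by
    rw [Subgroup.mem_center_iff]
    intro g
    have : g ∈ Subgroup.centralizer {(PresentedGroup.of a : Gstar p)} :=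
      PresentedGroup.generated_by _ _ (fun j => by
        rw [Subgroup.mem_centralizer_singleton_iff]
        exact commute_of (ha j).2 (ha j).1) g
    exact Subgroup.mem_centralizer_singleton_iff.1 this
  rw [A, Subgroup.closure_le]
  simp only [Set.insert_subset_iff, Set.singleton_subset_iff]
  refine ⟨?_, ?_, ?_, ?_, ?_, ?_, ?_, ?_⟩ <;>
    exact hcentral _ (by intro g; cases g <;> decide)

lemma A_le_commutator : A p ≤ commutator (Gstar p) := by
  have hmem (y x : Gen) (h : (x, y) ∉ specified) :
      ((commWord y x).map PresentedGroup.of).prod ∈ commutator (Gstar p) := by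
    rw [← comm_eq_commWord h]
    simpa [commutator_def, commutatorElement_def] using Subgroup.commutator_mem_commutator
      (Subgroup.mem_top ((PresentedGroup.of y : Gstar p)⁻¹))
      (Subgroup.mem_top ((PresentedGroup.of x : Gstar p)⁻¹))
  have hz2 := hmem y1 x2 (by decide)
  have hz2w2 := hmem y2 x1 (by decide)
  simp only [commWord, List.map_cons, List.map_nil, List.prod_cons, List.prod_nil,
    mul_one] at hz2 hz2w2
  rw [A, Subgroup.closure_le]
  simp only [Set.insert_subset_iff, Set.singleton_subset_iff]
  refine ⟨?_, (Subgroup.mul_mem_cancel_left _ hz2).1 hz2w2, ?_, ?_, ?_, ?_, ?_, ?_⟩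
  · simpa [commWord] using hmem x2 x1 (by decide)
  · simpa [commWord] using hmem y2 x2 (by decide)
  · simpa [commWord] using hmem y2 y1 (by decide)
  · simpa [commWord] using hmem z1 y1 (by decide)
  · simpa [commWord] using hmem z1 y2 (by decide)
  · simpa [commWord] using hmem z1 x1 (by decide)
  · simpa [commWord] using hmem z1 x2 (by decide)

end Relations

/-- A concrete model of `G*`: the coordinates `aᵢ, bᵢ, cᵢ, vᵢ, uᵢ` are those of elements
`a, b, c, v, u` of the dual numbers over `R`, which are multiplied by
`v'' = v + v' + 2ca' + ba'²` and `u'' = u + u' + 2cb' + 2ba'b' + b²a'` on top of the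
Heisenberg law for `(a, b, c)`, and the coordinates `wᵢ` come from bilinear cocycles. -/
@[ext]
structure Cover (R : Type*) [CommRing R] where
  a1 : R := 0
  a2 : R := 0
  b1 : R := 0
  b2 : R := 0
  c1 : R := 0
  c2 : R := 0
  w1 : R := 0
  w2 : R := 0
  w3 : R := 0
  w4 : R := 0
  v1 : R := 0
  v2 : R := 0
  u1 : R := 0
  u2 : R := 0

section Cover

variable {R : Type*} [CommRing R]

@[simps]
instance : Mul (Cover R) where
  mul g h :=
    { a1 := g.a1 + h.a1
      a2 := g.a2 + h.a2
      b1 := g.b1 + h.b1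
      b2 := g.b2 + h.b2
      c1 := g.c1 + h.c1 + g.b1 * h.a1
      c2 := g.c2 + h.c2 + g.b1 * h.a2 + g.b2 * h.a1
      w1 := g.w1 + h.w1 + g.a2 * h.a1
      w2 := g.w2 + h.w2 + g.b2 * h.a1
      w3 := g.w3 + h.w3 + g.b2 * h.a2
      w4 := g.w4 + h.w4 + g.b2 * h.b1
      v1 := g.v1 + h.v1 + 2 * g.c1 * h.a1 + g.b1 * h.a1 ^ 2
      v2 := g.v2 + h.v2 + 2 * (g.c1 * h.a2 + g.c2 * h.a1) + 2 * g.b1 * h.a1 * h.a2 +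
        g.b2 * h.a1 ^ 2
      u1 := g.u1 + h.u1 + 2 * g.c1 * h.b1 + 2 * g.b1 * h.a1 * h.b1 + g.b1 ^ 2 * h.a1
      u2 := g.u2 + h.u2 + 2 * (g.c1 * h.b2 + g.c2 * h.b1) +
        2 * (g.b1 * h.a1 * h.b2 + g.b1 * h.a2 * h.b1 + g.b2 * h.a1 * h.b1) +
        g.b1 ^ 2 * h.a2 + 2 * g.b1 * g.b2 * h.a1 }

@[simps]
instance : One (Cover R) where
  one := {}

@[simps]
instance : Inv (Cover R) where
  inv g :=
    { a1 := -g.a1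
      a2 := -g.a2
      b1 := -g.b1
      b2 := -g.b2
      c1 := -g.c1 + g.b1 * g.a1
      c2 := -g.c2 + g.b1 * g.a2 + g.b2 * g.a1
      w1 := -g.w1 + g.a2 * g.a1
      w2 := -g.w2 + g.b2 * g.a1
      w3 := -g.w3 + g.b2 * g.a2
      w4 := -g.w4 + g.b2 * g.b1
      v1 := -g.v1 + 2 * g.c1 * g.a1 - g.b1 * g.a1 ^ 2
      v2 := -g.v2 + 2 * (g.c1 * g.a2 + g.c2 * g.a1) - 2 * g.b1 * g.a1 * g.a2 -
        g.b2 * g.a1 ^ 2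
      u1 := -g.u1 + 2 * g.c1 * g.b1 - g.a1 * g.b1 ^ 2
      u2 := -g.u2 + 2 * (g.c1 * g.b2 + g.c2 * g.b1) - 2 * g.a1 * g.b1 * g.b2 -
        g.a2 * g.b1 ^ 2 }

instance : Group (Cover R) where
  mul_assoc g h k := by ext <;> simp <;> ring
  one_mul g := by ext <;> simp
  mul_one g := by ext <;> simp
  inv_mul_cancel g := by ext <;> simp <;> ring

/-- The images in `Cover R` of the generators of `G*`. -/
@[simp]
def coverGen (R : Type*) [CommRing R] : Gen → Cover R
  | x1 => { a1 := 1 }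
  | x2 => { a2 := 1 }
  | y1 => { b1 := 1 }
  | y2 => { b2 := 1 }
  | z1 => { c1 := 1, v1 := 1, u1 := 1 }
  | z2 => { c2 := 1, u2 := 1 }
  | w1 => { w1 := 1 }
  | w2 => { w2 := 1, v2 := 1, u2 := -1 }
  | w3 => { w3 := 1 }
  | w4 => { w4 := 1 }
  | v1 => { v1 := 2 }
  | v2 => { v2 := 2 }
  | u1 => { u1 := 2 }
  | u2 => { u2 := 2 }

/-- Coordinatewise scaling; on the generators it is the power map. -/
@[simps]
def scale (r : R) (g : Cover R) : Cover R where
  a1 := r * g.a1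
  a2 := r * g.a2
  b1 := r * g.b1
  b2 := r * g.b2
  c1 := r * g.c1
  c2 := r * g.c2
  w1 := r * g.w1
  w2 := r * g.w2
  w3 := r * g.w3
  w4 := r * g.w4
  v1 := r * g.v1
  v2 := r * g.v2
  u1 := r * g.u1
  u2 := r * g.u2

lemma coverGen_pow (g : Gen) (n : ℕ) : coverGen R g ^ n = scale (n : R) (coverGen R g) := by
  induction n with
  | zero => ext <;> simp
  | succ n ih =>
    rw [pow_succ, ih]
    cases g <;> ext <;> simp <;> ring

/-- The coordinates `w, v, u` form a central subgroup of `Cover R`. -/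
@[simps]
def coverIncl (R : Type*) [CommRing R] : Multiplicative (Fin 8 → R) →* Cover R where
  toFun f :=
    { w1 := f.toAdd 0
      w2 := f.toAdd 1
      w3 := f.toAdd 2
      w4 := f.toAdd 3
      v1 := f.toAdd 4
      v2 := f.toAdd 5
      u1 := f.toAdd 6
      u2 := f.toAdd 7 }
  map_one' := by ext <;> simp
  map_mul' f g := by ext <;> simp

lemma coverIncl_injective : Function.Injective (coverIncl R) := by
  intro f g h
  simp only [Cover.ext_iff, coverIncl_apply_w1, coverIncl_apply_w2, coverIncl_apply_w3,
    coverIncl_apply_w4, coverIncl_apply_v1, coverIncl_apply_v2, coverIncl_apply_u1,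
    coverIncl_apply_u2] at h
  obtain ⟨-, -, -, -, -, -, h0, h1, h2, h3, h4, h5, h6, h7⟩ := h
  apply Multiplicative.toAdd.injective
  funext i
  fin_cases i <;> assumption

lemma mem_range_coverIncl {g : Cover R} : g ∈ (coverIncl R).range ↔
    g.a1 = 0 ∧ g.a2 = 0 ∧ g.b1 = 0 ∧ g.b2 = 0 ∧ g.c1 = 0 ∧ g.c2 = 0 := by
  constructor
  · rintro ⟨f, rfl⟩
    simp
  · rintro ⟨h1, h2, h3, h4, h5, h6⟩
    refine ⟨Multiplicative.ofAdd ![g.w1, g.w2, g.w3, g.w4, g.v1, g.v2, g.u1, g.u2], ?_⟩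
    ext <;> simp [*]

lemma commute_of_mem_range_coverIncl {g : Cover R} (hg : g ∈ (coverIncl R).range) (h : Cover R) :
    Commute g h := by
  obtain ⟨f, rfl⟩ := hg
  change _ * _ = _ * _
  ext <;> simp [add_comm]

lemma coverGen_commute {g h : Gen} (h₁ : (g, h) ∉ specified) (h₂ : (h, g) ∉ specified) :
    Commute (coverGen R g) (coverGen R h) := by
  have hcentral (g : Gen) (hg : g ∉ [x1, x2, y1, y2, z1, z2]) :
      coverGen R g ∈ (coverIncl R).range := by
    rw [mem_range_coverIncl]
    cases g <;> simp at hg ⊢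
  by_cases hg : g ∈ [x1, x2, y1, y2, z1, z2]
  · by_cases hh : h ∈ [x1, x2, y1, y2, z1, z2]
    · revert h₁ h₂
      simp only [List.mem_cons, List.not_mem_nil, or_false] at hg hh
      change _ → _ → _ * _ = _ * _
      rcases hg with rfl | rfl | rfl | rfl | rfl | rfl <;>
      rcases hh with rfl | rfl | rfl | rfl | rfl | rfl <;>
      intro h₁ h₂ <;>
      first
      | rfl
      | exact absurd (by decide) h₁
      | exact absurd (by decide) h₂
      | (ext <;> simp)
    · exact (commute_of_mem_range_coverIncl (hcentral h hh) _).symm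
  · exact commute_of_mem_range_coverIncl (hcentral g hg) _

lemma lift_coverGen_eq_one (p : ℕ) [CharP R p] :
    ∀ r ∈ rels p, FreeGroup.lift (coverGen R) r = 1 := by
  rintro r ((h | ⟨g, h, rfl, h₁, h₂⟩) | h)
  · simp only [Set.mem_insert_iff, Set.mem_singleton_iff] at h
    rcases h with rfl | rfl | rfl | rfl | rfl | rfl | rfl | rfl | rfl | rfl | rfl | rfl <;>
    · simp only [comm, _root_.map_mul, _root_.map_inv, FreeGroup.lift_apply_of]
      rw [mul_inv_eq_one, mul_assoc, ← mul_inv_rev, inv_mul_eq_iff_eq_mul]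
      ext <;> simp
  · simp only [comm, _root_.map_mul, _root_.map_inv, FreeGroup.lift_apply_of]
    rw [mul_assoc, ← mul_inv_rev, inv_mul_eq_one]
    exact coverGen_commute h₂ h₁
  · simp only [Set.mem_insert_iff, Set.mem_singleton_iff] at h
    have hpow (g : Gen) : FreeGroup.lift (coverGen R) (of g ^ p) = 1 := by
      rw [map_pow, FreeGroup.lift_apply_of, coverGen_pow, CharP.cast_eq_zero]
      ext <;> simp
    rcases h with rfl | rfl | rfl | rfl | rfl | rfl | rfl | rfl | rfl | rfl <;> exact hpow _

/-- The projection of the model onto the Heisenberg group of a ring with a square-zero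
element `t`. -/
@[simps]
def coverProj {Q : Type*} [CommRing Q] [Algebra R Q] (t : Q) (ht : t ^ 2 = 0) :
    Cover R →* Heisenberg Q where
  toFun g :=
    { a := algebraMap R Q g.a1 + algebraMap R Q g.a2 * t
      b := algebraMap R Q g.b1 + algebraMap R Q g.b2 * t
      c := algebraMap R Q g.c1 + algebraMap R Q g.c2 * t }
  map_one' := by ext <;> simp
  map_mul' g h := by
    ext
    · simp; ring
    · simp; ring
    · simp
      linear_combination -(algebraMap R Q g.b2 * algebraMap R Q h.a2) * ht

lemma card_cover : Nat.card (Cover R) = Nat.card R ^ 14 := by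
  let f : Cover R → (Fin 14 → R) := fun g =>
    ![g.a1, g.a2, g.b1, g.b2, g.c1, g.c2, g.w1, g.w2, g.w3, g.w4, g.v1, g.v2, g.u1, g.u2]
  let e : Cover R ≃ (Fin 14 → R) :=
    { toFun := f
      invFun := fun f => ⟨f 0, f 1, f 2, f 3, f 4, f 5, f 6, f 7, f 8, f 9, f 10, f 11, f 12, f 13⟩
      left_inv := fun g => rfl
      right_inv := fun f => by funext i; fin_cases i <;> rfl }
  rw [Nat.card_congr e, Nat.card_fun, Nat.card_fin]

end Cover

section Generation

variable {p : ℕ} [Fact p.Prime]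

lemma scale_coverGen_mem {S : Subgroup (Cover (ZMod p))} {g : Gen}
    (hg : coverGen (ZMod p) g ∈ S) (r : ZMod p) : scale r (coverGen (ZMod p) g) ∈ S := by
  rw [← ZMod.natCast_zmod_val r, ← coverGen_pow]
  exact pow_mem hg _

lemma two_ne_zero_of_odd (hodd : Odd p) : (2 : ZMod p) ≠ 0 := by
  intro h
  have hdvd : p ∣ 2 := (ZMod.natCast_eq_zero_iff 2 p).1 (by exact_mod_cast h)
  obtain rfl := (Nat.prime_dvd_prime_iff_eq Fact.out Nat.prime_two).1 hdvd
  exact absurd hodd (by decide)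

lemma range_coverIncl_le (hodd : Odd p) {S : Subgroup (Cover (ZMod p))}
    (hS : ∀ g ∈ [w1, w2, w3, w4, v1, v2, u1, u2], coverGen (ZMod p) g ∈ S) :
    (coverIncl (ZMod p)).range ≤ S := by
  have htwo := two_ne_zero_of_odd hodd
  intro g hg
  rw [mem_range_coverIncl] at hg
  obtain ⟨h1, h2, h3, h4, h5, h6⟩ := hg
  have key : g = scale g.w1 (coverGen _ w1) * scale g.w2 (coverGen _ w2) *
      scale g.w3 (coverGen _ w3) * scale g.w4 (coverGen _ w4) *
      scale (g.v1 / 2) (coverGen _ v1) * scale ((g.v2 - g.w2) / 2) (coverGen _ v2) *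
      scale (g.u1 / 2) (coverGen _ u1) * scale ((g.u2 + g.w2) / 2) (coverGen _ u2) := by
    ext <;> simp [*]
  rw [key]
  refine mul_mem (mul_mem (mul_mem (mul_mem (mul_mem (mul_mem (mul_mem ?_ ?_) ?_) ?_) ?_) ?_) ?_)
    ?_ <;> exact scale_coverGen_mem (hS _ (by decide)) _

lemma eq_top_of_coverGen_mem (hodd : Odd p) {S : Subgroup (Cover (ZMod p))}
    (hS : ∀ g, coverGen (ZMod p) g ∈ S) : S = ⊤ := by
  rw [eq_top_iff]
  intro g _
  set e : Cover (ZMod p) := scale g.a1 (coverGen _ x1) * scale g.a2 (coverGen _ x2) *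
      scale g.b1 (coverGen _ y1) * scale g.b2 (coverGen _ y2) *
      scale g.c1 (coverGen _ z1) * scale g.c2 (coverGen _ z2) with he
  have hmem : e ∈ S := by
    refine mul_mem (mul_mem (mul_mem (mul_mem (mul_mem ?_ ?_) ?_) ?_) ?_) ?_ <;>
      exact scale_coverGen_mem (hS _) _
  refine (Subgroup.mul_mem_cancel_left S (inv_mem hmem)).1
    (range_coverIncl_le hodd (fun _ _ => hS _) ?_)
  rw [mem_range_coverIncl]
  simp [he]

end Generation

section TruncatedPolynomials

variable {R : Type*} [CommRing R]

lemma exists_eq_add_mul_mk_X (q : R[X] ⧸ Ideal.span {(X : R[X]) ^ 2}) :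
    ∃ r s : R, algebraMap R _ r + algebraMap R _ s * Ideal.Quotient.mk _ X = q := by
  obtain ⟨f, rfl⟩ := Ideal.Quotient.mk_surjective q
  refine ⟨f.coeff 0, f.divX.coeff 0, ?_⟩
  change Ideal.Quotient.mk _ (C (f.coeff 0)) + Ideal.Quotient.mk _ (C (f.divX.coeff 0)) *
    Ideal.Quotient.mk _ X = _
  rw [← _root_.map_mul, ← map_add, Ideal.Quotient.eq, Ideal.mem_span_singleton]
  refine ⟨-f.divX.divX, ?_⟩
  linear_combination divX_mul_X_add f + X * divX_mul_X_add f.divX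

lemma eq_zero_of_add_mul_mk_X {r s : R}
    (h : algebraMap R (R[X] ⧸ Ideal.span {(X : R[X]) ^ 2}) r +
      algebraMap R _ s * Ideal.Quotient.mk _ X = 0) : r = 0 ∧ s = 0 := by
  change Ideal.Quotient.mk _ (C r) + Ideal.Quotient.mk _ (C s) * Ideal.Quotient.mk _ X = 0 at h
  rw [← _root_.map_mul, ← map_add, Ideal.Quotient.eq_zero_iff_mem, Ideal.mem_span_singleton,
    X_pow_dvd_iff] at h
  exact ⟨by simpa using h 0 (by decide), by simpa using h 1 (by decide)⟩

lemma mk_X_sq : (Ideal.Quotient.mk (Ideal.span {(X : R[X]) ^ 2}) X) ^ 2 = 0 := by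
  rw [← map_pow, Ideal.Quotient.eq_zero_iff_mem]
  exact Ideal.mem_span_singleton_self _

lemma coverProj_surjective : Function.Surjective
    (coverProj (R := R) (Ideal.Quotient.mk (Ideal.span {(X : R[X]) ^ 2}) X) mk_X_sq) := by
  rintro ⟨a, b, c⟩
  obtain ⟨a1, a2, rfl⟩ := exists_eq_add_mul_mk_X a
  obtain ⟨b1, b2, rfl⟩ := exists_eq_add_mul_mk_X b
  obtain ⟨c1, c2, rfl⟩ := exists_eq_add_mul_mk_X c
  exact ⟨{ a1 := a1, a2 := a2, b1 := b1, b2 := b2, c1 := c1, c2 := c2 }, rfl⟩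

lemma ker_coverProj :
    (coverProj (R := R) (Ideal.Quotient.mk (Ideal.span {(X : R[X]) ^ 2}) X) mk_X_sq).ker =
      (coverIncl R).range := by
  ext g
  rw [mem_range_coverIncl, MonoidHom.mem_ker, Heisenberg.ext_iff]
  constructor
  · rintro ⟨ha, hb, hc⟩
    have ha := eq_zero_of_add_mul_mk_X ha
    have hb := eq_zero_of_add_mul_mk_X hb
    have hc := eq_zero_of_add_mul_mk_X hc
    exact ⟨ha.1, ha.2, hb.1, hb.2, hc.1, hc.2⟩
  · rintro ⟨h1, h2, h3, h4, h5, h6⟩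
    simp [*]

end TruncatedPolynomials

/-- The homomorphism from `G*` to its concrete model. -/
def toCover (p : ℕ) : Gstar p →* Cover (ZMod p) :=
  PresentedGroup.toGroup (lift_coverGen_eq_one p)

lemma toCover_of {p : ℕ} (g : Gen) :
    toCover p (PresentedGroup.of g) = coverGen (ZMod p) g :=
  PresentedGroup.toGroup.of _

lemma toCover_surjective {p : ℕ} [Fact p.Prime] (hodd : Odd p) :
    Function.Surjective (toCover p) :=
  MonoidHom.range_eq_top.1 (eq_top_of_coverGen_mem hodd fun g => ⟨_, toCover_of g⟩)

lemma card_cover_zmod (p : ℕ) : Nat.card (Cover (ZMod p)) = p ^ 14 := by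
  rw [card_cover, Nat.card_zmod]

lemma toCover_bijective {p : ℕ} [Fact p.Prime] (hodd : Odd p) :
    Function.Bijective (toCover p) := by
  obtain ⟨hfin, hcard⟩ := finite_and_card_le (Fact.out : p.Prime).pos
  exact (toCover_surjective hodd).bijective_of_nat_card_le (by rwa [card_cover_zmod])

lemma map_toCover_A {p : ℕ} [Fact p.Prime] (hodd : Odd p) :
    (A p).map (toCover p) = (coverIncl (ZMod p)).range := by
  apply le_antisymm
  · rw [Subgroup.map_le_iff_le_comap, A, Subgroup.closure_le]
    simp only [Set.insert_subset_iff, Set.singleton_subset_iff, SetLike.mem_coe,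
      Subgroup.mem_comap, toCover_of, mem_range_coverIncl]
    simp
  · apply range_coverIncl_le hodd
    intro g hg
    refine ⟨PresentedGroup.of g, Subgroup.subset_closure ?_, toCover_of g⟩
    simp only [List.mem_cons, List.not_mem_nil, or_false] at hg
    rcases hg with rfl | rfl | rfl | rfl | rfl | rfl | rfl | rfl <;> simp

/-- For an odd prime `p`, the presented group `G*` has order `p¹⁴`, the subgroup `A`
generated by `w₁, w₂, w₃, w₄, u₁, u₂, v₁, v₂` is contained in `Z(G*) ∩ [G*,G*]`, is
isomorphic to `(ℤ/pℤ)⁸`, and `G*/A ≅ H₃(𝔽_p[t]/(t²))` (expressed via a surjective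
homomorphism with kernel `A`).  Hence `G*` is a representation group of
`H₃(𝔽_p[t]/(t²))`. -/
theorem Gstar_is_representation_group (p : ℕ) [Fact p.Prime] (hodd : Odd p) :
    Nat.card (Gstar p) = p ^ 14 ∧
    A p ≤ Subgroup.center (Gstar p) ⊓ commutator (Gstar p) ∧
    Nonempty (A p ≃* Multiplicative (Fin 8 → ZMod p)) ∧
    ∃ φ : Gstar p →* Heisenberg ((ZMod p)[X] ⧸ Ideal.span {(X : (ZMod p)[X]) ^ 2}),
      Function.Surjective φ ∧ φ.ker = A p := by
  have hbij := toCover_bijective hodd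
  refine ⟨(Nat.card_congr (Equiv.ofBijective _ hbij)).trans (card_cover_zmod p),
    le_inf A_le_center A_le_commutator, ⟨?_⟩, (coverProj _ mk_X_sq).comp (toCover p),
    coverProj_surjective.comp hbij.2, ?_⟩
  · exact ((A p).equivMapOfInjective _ hbij.1).trans
      ((MulEquiv.subgroupCongr (map_toCover_A hodd)).trans
        (MonoidHom.ofInjective coverIncl_injective).symm)
  · rw [← MonoidHom.comap_ker, ker_coverProj, ← map_toCover_A hodd,
      Subgroup.comap_map_eq_self_of_injective hbij.1]

end Stmt8
end
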